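/- arXiv:2510.20170 — 5 statements merged into one kernel-verified Lean document; each statement's English description precedes it below -/
import Mathlib

section
/- Let A = A₀ ⊕ A₁ be a ℤ/2ℤ-graded commutative ring such that (A₀, m₀) is a Noetherian local ring, A₁ is a nonzero finitely generated A₀-module, and x·y ∈ m₀ for all x, y ∈ A₁ (so that A is a Noetherian local ring with maximal ideal m₀ ⊕ A₁). Then A is a Cohen–Macaulay local ring if and only if A₀ is a Cohen–Macaulay local ring and A₁ is a maximal Cohen–Macaulay A₀-module, i.e., depth_{A₀}(A₁) = dim A₀. -/
open IsLocalRing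

/-- The depth of a module `M` over a Noetherian local ring `R`: the supremum of the lengths
of `M`-regular sequences contained in the maximal ideal of `R`. -/
noncomputable def moduleDepth (R M : Type*) [CommRing R] [IsLocalRing R]
    [AddCommGroup M] [Module R M] : ℕ∞ :=
  sSup {n : ℕ∞ | ∃ rs : List R, (rs.length : ℕ∞) = n ∧
    (∀ r ∈ rs, r ∈ maximalIdeal R) ∧ RingTheory.Sequence.IsRegular M rs}

open RingTheory.Sequence in
/-- There is an `M`-regular sequence of length `n` in the maximal ideal. -/
def HasReg (R : Type*) [CommRing R] [IsLocalRing R] (n : ℕ) (M : Type*)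
    [AddCommGroup M] [Module R M] : Prop :=
  ∃ rs : List R, rs.length = n ∧ (∀ r ∈ rs, r ∈ maximalIdeal R) ∧ IsRegular M rs

section general

open RingTheory.Sequence

variable {R : Type*} [CommRing R]

lemma exists_killed {M : Type*} [AddCommGroup M] [Module R M] [IsNoetherianRing R]
    [Module.Finite R M] [Nontrivial M] (I : Ideal R) (h : ∀ x ∈ I, ¬ IsSMulRegular M x) :
    ∃ v : M, v ≠ 0 ∧ ∀ x ∈ I, x • v = 0 := by
  have hexist : ∃ p ∈ associatedPrimes R M, I ≤ p := by
    rcases associatedPrimes.nonempty R M with ⟨Ia, hIa⟩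
    apply (Ideal.subset_union_prime_finite (associatedPrimes.finite R M) Ia Ia _).mp
    · rw [biUnion_associatedPrimes_eq_compl_regular R M]
      exact fun r hr ↦ h r hr
    · exact fun I hin _ _ ↦ IsAssociatedPrime.isPrime hin
  obtain ⟨p, pass, hp⟩ := hexist
  obtain ⟨hpp, v, hv⟩ := isAssociatedPrime_iff.mp (AssociatedPrimes.mem_iff.mp pass)
  refine ⟨v, ?_, ?_⟩
  · rintro rfl
    apply hpp.ne_top
    rw [hv]
    ext; simp
  · intro x hx
    have := hp hx
    rw [hv] at this
    simpa using this

lemma socle_transfer {M : Type*} [AddCommGroup M] [Module R M] (I : Ideal R) {x y : R}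
    (hy : y ∈ I) (hrx : IsSMulRegular M x) (hry : IsSMulRegular M y)
    (h : ∃ v : QuotSMulTop x M, v ≠ 0 ∧ ∀ a ∈ I, a • v = 0) :
    ∃ v : QuotSMulTop y M, v ≠ 0 ∧ ∀ a ∈ I, a • v = 0 := by
  obtain ⟨v, hv, hk⟩ := h
  obtain ⟨z, rfl⟩ := Submodule.Quotient.mk_surjective _ v
  have key : ∀ a ∈ I, ∃ u : M, x • u = a • z := by
    intro a ha
    have := hk a ha
    rw [← Submodule.Quotient.mk_smul, Submodule.Quotient.mk_eq_zero,
      Submodule.mem_smul_pointwise_iff_exists] at this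
    obtain ⟨u, -, hu⟩ := this
    exact ⟨u, hu⟩
  obtain ⟨w, hw⟩ := key y hy
  refine ⟨Submodule.Quotient.mk w, ?_, ?_⟩
  · intro h0
    rw [Submodule.Quotient.mk_eq_zero, Submodule.mem_smul_pointwise_iff_exists] at h0
    obtain ⟨u, -, hu⟩ := h0
    apply hv
    rw [Submodule.Quotient.mk_eq_zero, Submodule.mem_smul_pointwise_iff_exists]
    refine ⟨u, trivial, ?_⟩
    apply hry
    change y • x • u = y • z
    rw [← hw, ← hu, smul_comm]
  · intro a ha
    obtain ⟨u, hu⟩ := key a ha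
    rw [← Submodule.Quotient.mk_smul, Submodule.Quotient.mk_eq_zero,
      Submodule.mem_smul_pointwise_iff_exists]
    refine ⟨u, trivial, ?_⟩
    apply hrx
    change x • y • u = x • a • w
    rw [smul_comm x a w, hw, smul_comm x y u, hu, smul_comm]

lemma retract_weaklyRegular (rs : List R) : ∀ {M N : Type _} [AddCommGroup M] [Module R M]
    [AddCommGroup N] [Module R N] (f : M →ₗ[R] N) (g : N →ₗ[R] M)
    (_ : ∀ v, g (f v) = v) (_ : IsWeaklyRegular N rs), IsWeaklyRegular M rs := by
  induction rs with
  | nil => intros; exact .nil _ _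
  | cons r rs ih =>
    intro M N _ _ _ _ f g hfg h
    rw [isWeaklyRegular_cons_iff] at h ⊢
    refine ⟨h.1.of_injective f (Function.LeftInverse.injective hfg),
      ih (QuotSMulTop.map r f) (QuotSMulTop.map r g) ?_ h.2⟩
    intro v
    obtain ⟨z, rfl⟩ := Submodule.Quotient.mk_surjective _ v
    simp [hfg]

lemma sum_weaklyRegular (rs : List R) : ∀ {M N L : Type _} [AddCommGroup M] [Module R M]
    [AddCommGroup N] [Module R N] [AddCommGroup L] [Module R L]
    (f : M →ₗ[R] L) (g : L →ₗ[R] M) (f' : N →ₗ[R] L) (g' : L →ₗ[R] N)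
    (_ : ∀ v, f (g v) + f' (g' v) = v) (_ : IsWeaklyRegular M rs) (_ : IsWeaklyRegular N rs),
    IsWeaklyRegular L rs := by
  induction rs with
  | nil => intros; exact .nil _ _
  | cons r rs ih =>
    intro M N L _ _ _ _ _ _ f g f' g' hfg h h'
    rw [isWeaklyRegular_cons_iff] at h h' ⊢
    refine ⟨?_, ih (QuotSMulTop.map r f) (QuotSMulTop.map r g) (QuotSMulTop.map r f')
      (QuotSMulTop.map r g') ?_ h.2 h'.2⟩
    · rw [isSMulRegular_iff_right_eq_zero_of_smul]
      intro v hv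
      have h1 : g v = 0 := h.1.right_eq_zero_of_smul (by rw [← map_smul, hv, map_zero])
      have h2 : g' v = 0 := h'.1.right_eq_zero_of_smul (by rw [← map_smul, hv, map_zero])
      rw [← hfg v, h1, h2]; simp
    · intro v
      obtain ⟨z, rfl⟩ := Submodule.Quotient.mk_surjective _ v
      rw [QuotSMulTop.map_apply_mk, QuotSMulTop.map_apply_mk, QuotSMulTop.map_apply_mk,
        QuotSMulTop.map_apply_mk, ← Submodule.Quotient.mk_add, hfg]

variable [IsLocalRing R]

lemma hasReg_succ_iff {n : ℕ} {M : Type*} [AddCommGroup M] [Module R M] :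
    HasReg R (n + 1) M ↔
      ∃ x ∈ maximalIdeal R, IsSMulRegular M x ∧ HasReg R n (QuotSMulTop x M) := by
  constructor
  · rintro ⟨rs, hl, hm, hr⟩
    match rs, hl with
    | x :: rs, hl =>
      rw [isRegular_cons_iff] at hr
      exact ⟨x, hm x (by simp), hr.1, rs, by simpa using hl,
        fun r h => hm r (by simp [h]), hr.2⟩
  · rintro ⟨x, hx, hr, rs, hl, hm, hr'⟩
    refine ⟨x :: rs, by simp [hl], ?_, IsRegular.cons hr hr'⟩
    intro r h
    rcases List.mem_cons.mp h with rfl | h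
    · exact hx
    · exact hm r h

lemma HasReg.nontrivial {n : ℕ} {M : Type*} [AddCommGroup M] [Module R M]
    (h : HasReg R n M) : Nontrivial M := by
  obtain ⟨rs, _, _, hr⟩ := h
  exact hr.nontrivial

variable [IsNoetherianRing R]

lemma hasReg_swap {n : ℕ} {M : Type*} [AddCommGroup M] [Module R M] [Module.Finite R M]
    {x z : R} (hx : IsSMulRegular M x) (hz : IsSMulRegular (QuotSMulTop x M) z)
    (h : HasReg R n (QuotSMulTop z (QuotSMulTop x M))) :
    IsSMulRegular M z ∧ IsSMulRegular (QuotSMulTop z M) x ∧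
      HasReg R n (QuotSMulTop x (QuotSMulTop z M)) := by
  obtain ⟨rs, hl, hm, hr⟩ := h
  have h1 : IsRegular M (x :: z :: rs) := IsRegular.cons hx (IsRegular.cons hz hr)
  have h2 := IsLocalRing.isRegular_of_perm h1 (List.Perm.swap z x rs)
  rw [isRegular_cons_iff, isRegular_cons_iff] at h2
  exact ⟨h2.1, h2.2.1, rs, hl, hm, h2.2.2⟩

/-- An element of the maximal ideal regular on two modules of positive depth. -/
lemma exists_common {M N : Type*} [AddCommGroup M] [Module R M] [Module.Finite R M]
    [AddCommGroup N] [Module R N] [Module.Finite R N]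
    (hM : ¬ ∃ v : M, v ≠ 0 ∧ ∀ a ∈ maximalIdeal R, a • v = 0)
    (hN : ¬ ∃ v : N, v ≠ 0 ∧ ∀ a ∈ maximalIdeal R, a • v = 0) :
    ∃ z ∈ maximalIdeal R, IsSMulRegular M z ∧ IsSMulRegular N z := by
  rcases subsingleton_or_nontrivial (M × N) with hs | hs
  · have : Subsingleton M := ⟨fun a b => congrArg Prod.fst (hs.elim (a, (0:N)) (b, 0))⟩
    have : Subsingleton N := ⟨fun a b => congrArg Prod.snd (hs.elim ((0:M), a) (0, b))⟩
    exact ⟨0, zero_mem _, IsSMulRegular.zero, IsSMulRegular.zero⟩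
  by_contra! hcon
  have : ∃ v : M × N, v ≠ 0 ∧ ∀ a ∈ maximalIdeal R, a • v = 0 := by
    apply exists_killed
    intro z hz hr
    exact hcon z hz
      (hr.of_injective (LinearMap.inl R M N) LinearMap.inl_injective)
      (hr.of_injective (LinearMap.inr R M N) LinearMap.inr_injective)
  obtain ⟨⟨v, w⟩, hne, hk⟩ := this
  by_cases hv : v = 0
  · refine hN ⟨w, ?_, fun a ha => congrArg Prod.snd (hk a ha)⟩
    rintro rfl
    exact hne (by rw [hv]; rfl)
  · exact hM ⟨v, hv, fun a ha => congrArg Prod.fst (hk a ha)⟩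

lemma not_killed_of_hasReg {n : ℕ} {M : Type*} [AddCommGroup M] [Module R M]
    (h : HasReg R (n + 1) M) : ¬ ∃ v : M, v ≠ 0 ∧ ∀ a ∈ maximalIdeal R, a • v = 0 := by
  rintro ⟨v, hv, hk⟩
  obtain ⟨x, hx, hr, -⟩ := hasReg_succ_iff.mp h
  exact hv (hr.right_eq_zero_of_smul (hk x hx))

lemma hasReg_quot (n : ℕ) : ∀ {M : Type _} [AddCommGroup M] [Module R M] [Module.Finite R M]
    {x : R} (_ : x ∈ maximalIdeal R) (_ : IsSMulRegular M x) (_ : HasReg R (n + 1) M),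
    HasReg R n (QuotSMulTop x M) := by
  induction n with
  | zero =>
    intro M _ _ _ x hx hr h
    have := h.nontrivial
    have := nontrivial_quotSMulTop_of_mem_maximalIdeal M hx
    exact ⟨[], rfl, by simp, .nil _ _⟩
  | succ n ih =>
    intro M _ _ _ x hx hr h
    obtain ⟨y, hy, hry, hQ⟩ := hasReg_succ_iff.mp h
    have hky := not_killed_of_hasReg hQ
    have hkx : ¬ ∃ v : QuotSMulTop x M, v ≠ 0 ∧ ∀ a ∈ maximalIdeal R, a • v = 0 :=
      fun hc => hky (socle_transfer _ hy hr hry hc)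
    obtain ⟨z, hz, hzx, hzy⟩ := exists_common hkx hky
    have h1 := ih hz hzy hQ
    obtain ⟨-, hyz, h2⟩ := hasReg_swap hry hzy h1
    have h3 : HasReg R (n + 1) (QuotSMulTop z M) := hasReg_succ_iff.mpr ⟨y, hy, hyz, h2⟩
    have hw : IsRegular M [x, z] := by
      have := h.nontrivial
      refine .of_isWeaklyRegular_of_mem_maximalIdeal M (by
        simp only [List.mem_cons, List.not_mem_nil, or_false, forall_eq_or_imp, forall_eq]
        exact ⟨hx, hz⟩) ?_
      rw [isWeaklyRegular_cons_iff, isWeaklyRegular_singleton_iff]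
      exact ⟨hr, hzx⟩
    have hw' := IsLocalRing.isRegular_of_perm hw (List.Perm.swap z x [])
    rw [isRegular_cons_iff, isRegular_cons_iff] at hw'
    have h4 := ih hx hw'.2.1 h3
    obtain ⟨-, hzx', h5⟩ := hasReg_swap hw'.1 hw'.2.1 h4
    exact hasReg_succ_iff.mpr ⟨z, hz, hzx', h5⟩

lemma joint_reg (n : ℕ) : ∀ {M N : Type _} [AddCommGroup M] [Module R M] [Module.Finite R M]
    [AddCommGroup N] [Module R N] [Module.Finite R N]
    (_ : HasReg R n M) (_ : HasReg R n N),
    ∃ rs : List R, rs.length = n ∧ (∀ r ∈ rs, r ∈ maximalIdeal R) ∧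
      IsRegular M rs ∧ IsRegular N rs := by
  induction n with
  | zero =>
    intro M N _ _ _ _ _ _ h h'
    have := h.nontrivial
    have := h'.nontrivial
    exact ⟨[], rfl, by simp, .nil _ _, .nil _ _⟩
  | succ n ih =>
    intro M N _ _ _ _ _ _ h h'
    obtain ⟨z, hz, hM, hN⟩ := exists_common (not_killed_of_hasReg h) (not_killed_of_hasReg h')
    obtain ⟨rs, hl, hm, h1, h2⟩ := ih (hasReg_quot n hz hM h) (hasReg_quot n hz hN h')
    refine ⟨z :: rs, by simp [hl], ?_, .cons hM h1, .cons hN h2⟩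
    intro r h
    rcases List.mem_cons.mp h with rfl | h
    · exact hz
    · exact hm r h

lemma depth_eq_iff (M : Type*) [AddCommGroup M] [Module R M] [Module.Finite R M] [Nontrivial M]
    {d : ℕ} (hd : ringKrullDim R = d) :
    (moduleDepth R M : WithBot ℕ∞) = ringKrullDim R ↔ HasReg R d M := by
  have hle : ∀ rs : List R, IsRegular M rs → rs.length ≤ d := by
    intro rs hr
    have h1 := Module.supportDim_add_length_eq_supportDim_of_isRegular rs hr
    have h2 := Module.supportDim_le_ringKrullDim R M
    have h4 : Nontrivial (M ⧸ Ideal.ofList rs • (⊤ : Submodule R M)) :=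
      hr.quot_ofList_smul_nontrivial ⊤
    have h3 := (Module.supportDim_ne_bot_iff_nontrivial R
      (M ⧸ Ideal.ofList rs • (⊤ : Submodule R M))).mpr h4
    rw [hd, ← h1] at h2
    generalize Module.supportDim R (M ⧸ Ideal.ofList rs • (⊤ : Submodule R M)) = t at h2 h3
    have h0 : (0 : WithBot ℕ∞) ≤ t := by
      induction t with
      | bot => exact absurd rfl h3
      | coe t => exact_mod_cast zero_le
    have h5 : (rs.length : WithBot ℕ∞) ≤ d := le_trans (by simpa using add_le_add_left h0 _) h2
    exact_mod_cast h5
  rw [hd]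
  have hcast : ((d : ℕ) : WithBot ℕ∞) = ((d : ℕ∞) : WithBot ℕ∞) := rfl
  rw [hcast, WithBot.coe_inj]
  have hub : moduleDepth R M ≤ d := by
    refine sSup_le ?_
    rintro n ⟨rs, rfl, -, hr⟩
    exact_mod_cast hle rs hr
  constructor
  · intro h
    have : Nonempty {n : ℕ∞ | ∃ rs : List R, (rs.length : ℕ∞) = n ∧
      (∀ r ∈ rs, r ∈ maximalIdeal R) ∧ RingTheory.Sequence.IsRegular M rs} :=
      ⟨⟨0, [], by simp, by simp, .nil _ _⟩⟩
    have hmem := ENat.sSup_mem_of_nonempty_of_lt_top (lt_of_le_of_lt hub (ENat.natCast_lt_top d))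
    obtain ⟨rs, hl, hm, hr⟩ := hmem
    refine ⟨rs, ?_, hm, hr⟩
    have : (rs.length : ℕ∞) = d := hl.trans h
    exact_mod_cast this
  · rintro ⟨rs, hl, hm, hr⟩
    exact le_antisymm hub (le_sSup ⟨rs, by rw [hl], hm, hr⟩)

end general

lemma ringKrullDim_eq_of_integral' (R S : Type*) [CommRing R] [CommRing S] [Algebra R S]
    [Algebra.IsIntegral R S] (hinj : Function.Injective (algebraMap R S)) :
    ringKrullDim S = ringKrullDim R := by
  apply le_antisymm
  · refine Order.krullDim_le_of_strictMono (PrimeSpectrum.comap (algebraMap R S)) ?_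
    intro p q hpq
    exact Ideal.IsIntegral.comap_lt_comap (R := R) (I := p.asIdeal) (J := q.asIdeal) hpq
  · refine iSup_le ?_
    intro l
    obtain ⟨Q, -, hQ, hQ'⟩ := Ideal.exists_ideal_over_prime_of_isIntegral
      (S := S) l.head.asIdeal ⊥ (by
        rw [← RingHom.ker_eq_comap_bot, (RingHom.injective_iff_ker_eq_bot _).mp hinj]
        exact bot_le)
    have : Q.LiesOver l.head.asIdeal := ⟨hQ'.symm⟩
    obtain ⟨L, hL, -⟩ := Ideal.exists_ltSeries_of_hasGoingUp l Q
    rw [← hL]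
    exact le_iSup (fun p : LTSeries (PrimeSpectrum S) => (p.length : WithBot ℕ∞)) L

section descend

open RingTheory.Sequence

variable {R S : Type*} [CommRing R] [CommRing S] [Algebra R S] [IsLocalRing R] [IsLocalRing S]
  [IsNoetherianRing R] [IsNoetherianRing S] [Module.Finite R S]

lemma descend_reg (hloc : ∀ y ∈ maximalIdeal R, algebraMap R S y ∈ maximalIdeal S)
    (hsq : ∀ a ∈ maximalIdeal S, ∀ b ∈ maximalIdeal S,
      a * b ∈ Ideal.map (algebraMap R S) (maximalIdeal R)) (n : ℕ) :
    ∀ {M : Type _} [AddCommGroup M] [Module S M] [Module.Finite S M] (_ : HasReg S n M),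
    ∃ rs : List R, rs.length = n ∧ (∀ r ∈ rs, r ∈ maximalIdeal R) ∧
      IsRegular M (rs.map (algebraMap R S)) := by
  induction n with
  | zero =>
    intro M _ _ _ h
    have := h.nontrivial
    exact ⟨[], rfl, by simp, .nil _ _⟩
  | succ n ih =>
    intro M _ _ _ h
    have hnt := h.nontrivial
    have hk := not_killed_of_hasReg h
    let : Module R M := Module.compHom M (algebraMap R S)
    have : IsScalarTower R S M := ⟨fun r s m => by
      rw [Algebra.smul_def, mul_smul]; rfl⟩
    have : Module.Finite R M := Module.Finite.trans S M
    have : ∃ y ∈ maximalIdeal R, IsSMulRegular M y := by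
      by_contra! hcon
      obtain ⟨v, hv, hkv⟩ := exists_killed (maximalIdeal R) hcon
      have hker : ∀ a ∈ Ideal.map (algebraMap R S) (maximalIdeal R), a • v = 0 := by
        intro a ha
        have : Ideal.map (algebraMap R S) (maximalIdeal R) ≤
            LinearMap.ker (LinearMap.toSpanSingleton S M v) := by
          rw [Ideal.map_le_iff_le_comap]
          intro y hy
          simpa using hkv y hy
        simpa using this ha
      by_cases hall : ∀ a ∈ maximalIdeal S, a • v = 0
      · exact hk ⟨v, hv, hall⟩
      · push Not at hall
        obtain ⟨a, ha, hav⟩ := hall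
        refine hk ⟨a • v, hav, fun b hb => ?_⟩
        rw [← mul_smul]
        exact hker _ (hsq b hb a ha)
    obtain ⟨y, hy, hreg⟩ := this
    have hreg' : IsSMulRegular M (algebraMap R S y) := by
      intro a b hab
      apply hreg
      simpa using hab
    obtain ⟨rs, hl, hm, hr⟩ := ih (hasReg_quot n (hloc y hy) hreg' h)
    refine ⟨y :: rs, by simp [hl], ?_, ?_⟩
    · intro r h
      rcases List.mem_cons.mp h with rfl | h
      · exact hy
      · exact hm r h
    · rw [List.map_cons]
      exact .cons hreg' hr

end descend

/-- Let `A = A₀ ⊕ A₁` be a `ℤ/2ℤ`-graded commutative ring (`A₀` a subring, `A₁` an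
`A₀`-submodule, `A = A₀ ⊕ A₁` additively, `A₁·A₁ ⊆ A₀`) such that `(A₀, m₀)` is a
Noetherian local ring, `A₁` is a nonzero finitely generated `A₀`-module, and `x·y ∈ m₀`
for all `x, y ∈ A₁` (so that `A` is a Noetherian local ring with maximal ideal `m₀ ⊕ A₁`).
Then `A` is Cohen–Macaulay (depth `A` = dim `A`) iff `A₀` is Cohen–Macaulay and `A₁` is a
maximal Cohen–Macaulay `A₀`-module (depth_{A₀}(A₁) = dim A₀). -/
theorem cohenMacaulay_iff_of_z2graded {A : Type*} [CommRing A]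
    (A₀ : Subring A) (A₁ : Submodule A₀ A)
    [IsNoetherianRing A₀] [IsLocalRing A₀]
    (hgr : ∀ x ∈ A₁, ∀ y ∈ A₁, x * y ∈ A₀)
    (hdisj : A₀.toAddSubgroup ⊓ A₁.toAddSubgroup = ⊥)
    (hspan : A₀.toAddSubgroup ⊔ A₁.toAddSubgroup = ⊤)
    (hA₁ne : A₁ ≠ ⊥) (hA₁fg : A₁.FG)
    (hm : ∀ x ∈ A₁, ∀ y ∈ A₁, ∀ h : x * y ∈ A₀, (⟨x * y, h⟩ : A₀) ∈ maximalIdeal A₀)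
    [IsNoetherianRing A] [IsLocalRing A] :
    ringKrullDim A = (moduleDepth A A : WithBot ℕ∞) ↔
      (ringKrullDim A₀ = (moduleDepth A₀ A₀ : WithBot ℕ∞) ∧
        (moduleDepth A₀ A₁ : WithBot ℕ∞) = ringKrullDim A₀) := by
  -- decomposition of `A` as an `A₀`-module
  have hinj : Function.Injective (algebraMap A₀ A) := Subtype.val_injective
  let S₀ : Submodule A₀ A := LinearMap.range (Algebra.linearMap A₀ A)
  have hS₀ : ∀ x : A, x ∈ S₀ ↔ x ∈ A₀ := fun x =>
    ⟨by rintro ⟨y, rfl⟩; exact y.2, fun h => ⟨⟨x, h⟩, rfl⟩⟩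
  have hdec : ∀ x : A, ∃ a ∈ A₀, ∃ b ∈ A₁, a + b = x := by
    intro x
    have : x ∈ A₀.toAddSubgroup ⊔ A₁.toAddSubgroup := hspan ▸ AddSubgroup.mem_top x
    obtain ⟨a, ha, b, hb, hab⟩ := AddSubgroup.mem_sup.mp this
    exact ⟨a, ha, b, hb, hab⟩
  have hzero : ∀ x : A, x ∈ A₀ → x ∈ A₁ → x = 0 := by
    intro x h0 h1
    have : x ∈ A₀.toAddSubgroup ⊓ A₁.toAddSubgroup := ⟨h0, h1⟩
    rw [hdisj] at this
    simpa using this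
  have hcompl : IsCompl S₀ A₁ := by
    refine ⟨?_, ?_⟩
    · rw [Submodule.disjoint_def]
      exact fun x h0 h1 => hzero x ((hS₀ x).mp h0) h1
    · rw [codisjoint_iff, eq_top_iff]
      intro x _
      obtain ⟨a, ha, b, hb, rfl⟩ := hdec x
      exact Submodule.add_mem_sup ((hS₀ a).mpr ha) hb
  let e : A₀ ≃ₗ[A₀] S₀ := LinearEquiv.ofInjective (Algebra.linearMap A₀ A) hinj
  let p₀ : A →ₗ[A₀] A₀ := e.symm.toLinearMap ∘ₗ S₀.projectionOnto A₁ hcompl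
  let p₁ : A →ₗ[A₀] A₁ := A₁.projectionOnto S₀ hcompl.symm
  let i₀ : A₀ →ₗ[A₀] A := Algebra.linearMap A₀ A
  let i₁ : A₁ →ₗ[A₀] A := A₁.subtype
  have hp₀ : ∀ v, p₀ (i₀ v) = v := by
    intro v
    have h1 : S₀.projectionOnto A₁ hcompl (i₀ v) = e v :=
      Submodule.projectionOnto_apply_left hcompl (e v)
    change e.symm (S₀.projectionOnto A₁ hcompl (i₀ v)) = v
    rw [h1, LinearEquiv.symm_apply_apply]
  have hp₁ : ∀ v, p₁ (i₁ v) = v := by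
    intro v
    exact Submodule.projectionOnto_apply_left hcompl.symm v
  have hp₀' : ∀ v, p₀ (i₁ v) = 0 := by
    intro v
    have h1 : S₀.projectionOnto A₁ hcompl (i₁ v) = 0 :=
      Submodule.projectionOnto_apply_right hcompl v
    change e.symm (S₀.projectionOnto A₁ hcompl (i₁ v)) = 0
    rw [h1, map_zero]
  have hp₁' : ∀ v, p₁ (i₀ v) = 0 := by
    intro v
    exact Submodule.projectionOnto_apply_right hcompl.symm (e v)
  have hsum : ∀ v, i₀ (p₀ v) + i₁ (p₁ v) = v := by
    intro v
    obtain ⟨a, ha, b, hb, rfl⟩ := hdec v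
    have ha' : a = i₀ ⟨a, ha⟩ := rfl
    have hb' : b = i₁ ⟨b, hb⟩ := rfl
    rw [ha', hb', map_add p₀, map_add p₁, hp₀, hp₀', hp₁, hp₁', add_zero, zero_add]
  have : Module.Finite A₀ A₁ := Module.Finite.iff_fg.mpr hA₁fg
  have : Nontrivial A₁ := Submodule.nontrivial_iff_ne_bot.mpr hA₁ne
  have : Module.Finite A₀ A := by
    refine ⟨?_⟩
    rw [← hcompl.sup_eq_top]
    refine Submodule.FG.sup ?_ hA₁fg
    exact Module.Finite.iff_fg.mp (Module.Finite.equiv e)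
  have hdim : ringKrullDim A = ringKrullDim A₀ := ringKrullDim_eq_of_integral' A₀ A hinj
  obtain ⟨d, hd⟩ : ∃ d : ℕ, ringKrullDim A₀ = d := by
    have h1 : ringKrullDim A₀ ≠ ⊥ := ringKrullDim_ne_bot
    have h2 : ringKrullDim A₀ ≠ ⊤ := ringKrullDim_ne_top
    generalize ringKrullDim A₀ = t at h1 h2
    induction t with
    | bot => exact absurd rfl h1
    | coe t =>
      induction t with
      | top => exact absurd rfl h2
      | coe t => exact ⟨t, rfl⟩
  -- locality
  have hunit : ∀ y : A₀, IsUnit (y : A) → IsUnit y := by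
    intro y hy
    obtain ⟨b, hb⟩ := hy.exists_right_inv
    refine IsUnit.of_mul_eq_one (p₀ b) ?_
    have h1 : y • b = i₀ 1 := hb
    rw [← smul_eq_mul, ← map_smul, h1, hp₀]
  have hloc : ∀ y ∈ maximalIdeal A₀, algebraMap A₀ A y ∈ maximalIdeal A := by
    intro y hy
    rw [mem_maximalIdeal, mem_nonunits_iff] at hy ⊢
    exact fun h => hy (hunit y h)
  have hA₁max : ∀ b ∈ A₁, b ∈ maximalIdeal A := by
    intro b hb
    have h1 : algebraMap A₀ A ⟨b * b, hgr b hb b hb⟩ ∈ maximalIdeal A :=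
      hloc _ (hm b hb b hb _)
    have h2 : b * b ∈ maximalIdeal A := h1
    exact ((maximalIdeal.isMaximal A).isPrime.mem_or_mem h2).elim id id
  have hmdec : ∀ x ∈ maximalIdeal A, ∃ a ∈ maximalIdeal A₀, ∃ b ∈ A₁,
      algebraMap A₀ A a + b = x := by
    intro x hx
    obtain ⟨a, ha, b, hb, rfl⟩ := hdec x
    refine ⟨⟨a, ha⟩, ?_, b, hb, rfl⟩
    have h1 : a ∈ maximalIdeal A := by
      simpa using Ideal.sub_mem _ hx (hA₁max b hb)
    rw [mem_maximalIdeal, mem_nonunits_iff] at h1 ⊢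
    exact fun h => h1 (h.map (algebraMap A₀ A))
  have hsq : ∀ a ∈ maximalIdeal A, ∀ b ∈ maximalIdeal A,
      a * b ∈ Ideal.map (algebraMap A₀ A) (maximalIdeal A₀) := by
    intro x hx y hy
    obtain ⟨a, ha, b, hb, rfl⟩ := hmdec x hx
    obtain ⟨a', ha', b', hb', rfl⟩ := hmdec y hy
    have k1 := Ideal.mem_map_of_mem (algebraMap A₀ A) ha
    have k2 := Ideal.mem_map_of_mem (algebraMap A₀ A) ha'
    have k3 : b * b' ∈ Ideal.map (algebraMap A₀ A) (maximalIdeal A₀) :=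
      Ideal.mem_map_of_mem (algebraMap A₀ A) (hm b hb b' hb' (hgr b hb b' hb'))
    have : (algebraMap A₀ A a + b) * (algebraMap A₀ A a' + b') =
        (algebraMap A₀ A a' + b') * algebraMap A₀ A a + b * algebraMap A₀ A a' + b * b' := by ring
    rw [this]
    exact Ideal.add_mem _ (Ideal.add_mem _ (Ideal.mul_mem_left _ _ k1)
      (Ideal.mul_mem_left _ _ k2)) k3
  rw [eq_comm, depth_eq_iff A (hdim.trans hd), depth_eq_iff A₁ hd, eq_comm, depth_eq_iff A₀ hd]
  constructor
  · intro h
    obtain ⟨rs, hl, hmem, hr⟩ := descend_reg hloc hsq d h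
    have hw : RingTheory.Sequence.IsWeaklyRegular A rs :=
      (RingTheory.Sequence.isWeaklyRegular_map_algebraMap_iff A A rs).mp hr.1
    exact ⟨⟨rs, hl, hmem, .of_isWeaklyRegular_of_mem_maximalIdeal _ hmem
        (retract_weaklyRegular rs i₀ p₀ hp₀ hw)⟩,
      ⟨rs, hl, hmem, .of_isWeaklyRegular_of_mem_maximalIdeal _ hmem
        (retract_weaklyRegular rs i₁ p₁ hp₁ hw)⟩⟩
  · rintro ⟨h0, h1⟩
    obtain ⟨rs, hl, hmem, hr0, hr1⟩ := joint_reg d h0 h1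
    have hw : RingTheory.Sequence.IsWeaklyRegular A rs :=
      sum_weaklyRegular rs i₀ p₀ i₁ p₁ hsum hr0.1 hr1.1
    have hmem' : ∀ r ∈ rs.map (algebraMap A₀ A), r ∈ maximalIdeal A := by
      intro r hr
      obtain ⟨s, hs, rfl⟩ := List.mem_map.mp hr
      exact hloc s (hmem s hs)
    exact ⟨rs.map (algebraMap A₀ A), by simp [hl], hmem',
      .of_isWeaklyRegular_of_mem_maximalIdeal _ hmem'
        ((RingTheory.Sequence.isWeaklyRegular_map_algebraMap_iff A A rs).mpr hw)⟩
end

section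
/- Let (R, m) be an Artinian local ring containing a field K such that the composite homomorphism K → R → R/m is bijective, with R ≠ K, and let ξ ∈ m be an element with R·ξ = (0) :_R m. Let s ≥ 1 and let C = (c_{ij}) be a symmetric s × s matrix with entries in K. In the polynomial ring S = R[X₁, …, X_s], let I be the ideal I = (X_iX_j − c_{ij}ξ : 1 ≤ i, j ≤ s) + m·(X₁, …, X_s). Then ℓ_R(S/I) = ℓ_R(R) + s. -/
open IsLocalRing

/-- The length of an `R`-module `M`, realized as the Krull dimension of its lattice of
submodules (for modules of finite length this is the common length of all composition
series). -/
noncomputable def moduleLength (R M : Type*) [Semiring R] [AddCommMonoid M]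
    [Module R M] : WithBot ℕ∞ :=
  Order.krullDim (Submodule R M)


/-- Data for the ring structure on `R × V`. -/
structure ExtData (R V : Type*) [CommRing R] [AddCommGroup V] [Module R V] where
  B : V →ₗ[R] V →ₗ[R] R
  symm : ∀ u v : V, B u v = B v u
  kills : ∀ u v w : V, (B u v : R) • w = 0

/-- The underlying module of the extension. -/
def ExtRing {R V : Type*} [CommRing R] [AddCommGroup V] [Module R V]
    (_D : ExtData R V) : Type _ := R × V

namespace ExtRing

variable {R V : Type*} [CommRing R] [AddCommGroup V] [Module R V] (D : ExtData R V)

instance : AddCommGroup (ExtRing D) := inferInstanceAs (AddCommGroup (R × V))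
instance : Module R (ExtRing D) := inferInstanceAs (Module R (R × V))
instance : Mul (ExtRing D) :=
  ⟨fun x y => ((x.1 * y.1 + D.B x.2 y.2, x.1 • y.2 + y.1 • x.2) : R × V)⟩
instance : One (ExtRing D) := ⟨((1, 0) : R × V)⟩

variable {D}

theorem ext' {x y : ExtRing D} (h1 : x.1 = y.1) (h2 : x.2 = y.2) : x = y := Prod.ext h1 h2
theorem mul_fst (x y : ExtRing D) : (x * y).1 = x.1 * y.1 + D.B x.2 y.2 := rfl
theorem mul_snd (x y : ExtRing D) : (x * y).2 = x.1 • y.2 + y.1 • x.2 := rfl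
theorem add_fst (x y : ExtRing D) : (x + y).1 = x.1 + y.1 := rfl
theorem add_snd (x y : ExtRing D) : (x + y).2 = x.2 + y.2 := rfl
theorem one_fst : (1 : ExtRing D).1 = 1 := rfl
theorem one_snd : (1 : ExtRing D).2 = 0 := rfl
theorem zero_fst : (0 : ExtRing D).1 = 0 := rfl
theorem zero_snd : (0 : ExtRing D).2 = 0 := rfl
theorem smul_fst (r : R) (x : ExtRing D) : (r • x).1 = r * x.1 := rfl
theorem smul_snd (r : R) (x : ExtRing D) : (r • x).2 = r • x.2 := rfl

theorem mul_comm' (x y : ExtRing D) : x * y = y * x := by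
  apply ext'
  · rw [mul_fst, mul_fst, D.symm, mul_comm]
  · rw [mul_snd, mul_snd, add_comm]

theorem left_distrib' (x y z : ExtRing D) : x * (y + z) = x * y + x * z := by
  apply ext'
  · simp only [mul_fst, add_fst, add_snd, map_add]; ring
  · simp only [mul_snd, add_fst, add_snd, smul_add, add_smul]; abel

theorem mul_assoc' (x y z : ExtRing D) : x * y * z = x * (y * z) := by
  apply ext'
  · simp only [mul_fst, mul_snd, map_add, map_smul, LinearMap.add_apply,
      LinearMap.smul_apply, smul_eq_mul, D.symm z.2]
    rw [D.symm x.2 z.2]; ring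
  · simp only [mul_fst, mul_snd, smul_add, add_smul, D.kills, smul_smul, mul_comm]
    rw [add_zero, add_zero, add_assoc]

theorem one_mul' (x : ExtRing D) : 1 * x = x := by
  apply ext'
  · simp [mul_fst, one_fst, one_snd]
  · simp [mul_snd, one_fst, one_snd]

theorem zero_mul' (x : ExtRing D) : 0 * x = 0 := by
  apply ext'
  · simp [mul_fst, zero_fst, zero_snd]
  · simp [mul_snd, zero_fst, zero_snd]

instance : CommRing (ExtRing D) :=
  { (inferInstance : AddCommGroup (ExtRing D)) with
    mul := (· * ·)
    one := 1
    mul_comm := mul_comm'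
    mul_assoc := mul_assoc'
    one_mul := one_mul'
    mul_one := fun x => by rw [mul_comm', one_mul']
    left_distrib := left_distrib'
    right_distrib := fun x y z => by
      rw [mul_comm', left_distrib', mul_comm' z, mul_comm' z]
    zero_mul := zero_mul'
    mul_zero := fun x => by rw [mul_comm', zero_mul'] }

instance : Algebra R (ExtRing D) :=
  Algebra.ofModule
    (fun r x y => by
      apply ext'
      · simp only [mul_fst, smul_fst, smul_snd, map_smul, LinearMap.smul_apply, smul_eq_mul]; ring
      · simp only [mul_snd, smul_fst, smul_snd, smul_add, smul_smul, mul_comm r])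
    (fun r x y => by
      apply ext'
      · simp only [mul_fst, smul_fst, smul_snd, map_smul, LinearMap.smul_apply, smul_eq_mul]; ring
      · simp only [mul_snd, smul_fst, smul_snd, smul_add, smul_smul, mul_comm])

theorem algebraMap_eq (r : R) : algebraMap R (ExtRing D) r = ((r, 0) : R × V) := by
  rw [Algebra.algebraMap_eq_smul_one]
  apply ext'
  · exact mul_one r
  · exact smul_zero r

end ExtRing

section Main
variable {R : Type*} [CommRing R] [IsLocalRing R]

theorem residue_smul_zero {r : R} (hr : r ∈ maximalIdeal R) {s : ℕ} (w : Fin s → R ⧸ maximalIdeal R) :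
    r • w = 0 := by
  funext i
  obtain ⟨t, ht⟩ := Ideal.Quotient.mk_surjective (w i)
  rw [Pi.smul_apply, ← ht, ← Ideal.Quotient.mk_eq_mk, ← Submodule.Quotient.mk_smul]
  exact (Submodule.Quotient.mk_eq_zero _).2 (Ideal.mul_mem_right _ _ hr)

/-- A map from the residue field, sending the class of 1 to an element killed by `m`. -/
noncomputable def resLift {M : Type*} [AddCommGroup M] [Module R M] (x : M)
    (hx : ∀ r ∈ maximalIdeal R, r • x = 0) : (R ⧸ maximalIdeal R) →ₗ[R] M :=
  Submodule.liftQ (maximalIdeal R) (LinearMap.toSpanSingleton R M x) hx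

theorem resLift_mk {M : Type*} [AddCommGroup M] [Module R M] (x : M)
    (hx : ∀ r ∈ maximalIdeal R, r • x = 0) (r : R) :
    resLift x hx (Ideal.Quotient.mk _ r) = r • x := rfl

/-- The data attached to a symmetric matrix. -/
noncomputable def matData (ξ : R) (hξm : ξ ∈ maximalIdeal R)
    (hx : ∀ r ∈ maximalIdeal R, r • ξ = 0) {s : ℕ} (c : Fin s → Fin s → R)
    (hc : ∀ i j, c i j = c j i) : ExtData R (Fin s → R ⧸ maximalIdeal R) where
  B := LinearMap.mk₂ R (fun u v => resLift ξ hx (∑ i, ∑ j, c i j • (u i * v j)))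
    (fun u u' v => by
      simp only [Pi.add_apply, add_mul, smul_add, Finset.sum_add_distrib, map_add])
    (fun r u v => by
      simp only [Pi.smul_apply, smul_mul_assoc, smul_comm _ r, ← Finset.smul_sum, map_smul])
    (fun u v v' => by
      simp only [Pi.add_apply, mul_add, smul_add, Finset.sum_add_distrib, map_add])
    (fun r u v => by
      simp only [Pi.smul_apply, mul_smul_comm, smul_comm _ r, ← Finset.smul_sum, map_smul])
  symm u v := by
    simp only [LinearMap.mk₂_apply]
    rw [Finset.sum_comm]
    simp only [mul_comm, hc]
  kills u v w := by
    apply residue_smul_zero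
    simp only [LinearMap.mk₂_apply]
    obtain ⟨t, ht⟩ := Ideal.Quotient.mk_surjective (∑ i, ∑ j, c i j • (u i * v j))
    rw [← ht, resLift_mk]
    exact Ideal.mul_mem_left _ _ hξm

theorem matData_single (ξ : R) (hξm : ξ ∈ maximalIdeal R)
    (hx : ∀ r ∈ maximalIdeal R, r • ξ = 0) {s : ℕ} (c : Fin s → Fin s → R)
    (hc : ∀ i j, c i j = c j i) (i j : Fin s) :
    (matData ξ hξm hx c hc).B (Pi.single i 1) (Pi.single j 1) = c i j * ξ := by
  have : ∑ k, ∑ l, c k l • ((Pi.single i 1 : Fin s → R ⧸ maximalIdeal R) k *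
      (Pi.single j 1 : Fin s → R ⧸ maximalIdeal R) l) = Ideal.Quotient.mk _ (c i j) := by
    rw [Finset.sum_eq_single i, Finset.sum_eq_single j]
    · rw [Pi.single_eq_same, Pi.single_eq_same, mul_one, Algebra.smul_def, mul_one]; rfl
    · intro l _ hl; rw [Pi.single_eq_of_ne hl, mul_zero, smul_zero]
    · simp
    · intro k _ hk; simp [Pi.single_eq_of_ne hk]
    · simp
  simp only [matData, LinearMap.mk₂_apply]
  rw [this, resLift_mk, smul_eq_mul]

theorem main_equiv (ξ : R) (hξm : ξ ∈ maximalIdeal R)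
    (hx : ∀ r ∈ maximalIdeal R, r • ξ = 0) {s : ℕ} (c : Fin s → Fin s → R)
    (hc : ∀ i j, c i j = c j i) (I : Ideal (MvPolynomial (Fin s) R))
    (hI : I = Ideal.span
        ({p : MvPolynomial (Fin s) R | ∃ i j : Fin s,
            p = MvPolynomial.X i * MvPolynomial.X j
              - MvPolynomial.C (c i j * ξ)} ∪
         {p : MvPolynomial (Fin s) R | ∃ a ∈ maximalIdeal R, ∃ i : Fin s,
            p = MvPolynomial.C a * MvPolynomial.X i})) :
    Nonempty ((R × (Fin s → R ⧸ maximalIdeal R)) ≃ₗ[R] (MvPolynomial (Fin s) R ⧸ I)) := by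
  classical
  let D := matData ξ hξm hx c hc
  let e : Fin s → ExtRing D := fun i =>
    ((0, Pi.single i 1) : R × (Fin s → R ⧸ maximalIdeal R))
  let f : MvPolynomial (Fin s) R →ₐ[R] ExtRing D := MvPolynomial.aeval e
  have hf : ∀ p ∈ I, f p = 0 := by
    have : I ≤ RingHom.ker f := by
      rw [hI, Ideal.span_le]
      rintro p (⟨i, j, rfl⟩ | ⟨a, ha, i, rfl⟩)
      · change f _ = 0
        rw [map_sub, map_mul, sub_eq_zero, MvPolynomial.aeval_X, MvPolynomial.aeval_X,
          MvPolynomial.aeval_C, ExtRing.algebraMap_eq]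
        apply ExtRing.ext'
        · rw [ExtRing.mul_fst]
          change 0 * 0 + D.B (Pi.single i 1) (Pi.single j 1) = _
          rw [matData_single, mul_zero, zero_add]
        · rw [ExtRing.mul_snd]
          change (0 : R) • _ + (0 : R) • _ = 0
          rw [zero_smul, zero_smul, zero_add]
      · change f _ = 0
        rw [map_mul, MvPolynomial.aeval_X, MvPolynomial.aeval_C, ← Algebra.smul_def]
        apply ExtRing.ext'
        · exact mul_zero a
        · exact residue_smul_zero ha _
    exact this
  let fb : (MvPolynomial (Fin s) R ⧸ I) →ₐ[R] ExtRing D := Ideal.Quotient.liftₐ I f hf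
  have hm : ∀ i : Fin s, ∀ r ∈ maximalIdeal R,
      r • (Ideal.Quotient.mk I (MvPolynomial.X i)) = 0 := by
    intro i r hr
    have : MvPolynomial.C r * MvPolynomial.X i ∈ I := by
      rw [hI]; exact Ideal.subset_span (Or.inr ⟨r, hr, i, rfl⟩)
    rw [← Ideal.Quotient.eq_zero_iff_mem, MvPolynomial.C_mul'] at this
    exact this
  let g2 : (Fin s → R ⧸ maximalIdeal R) →ₗ[R] (MvPolynomial (Fin s) R ⧸ I) :=
    LinearMap.lsum R (fun _ => R ⧸ maximalIdeal R) R (fun i => resLift _ (hm i))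
  let g : (R × (Fin s → R ⧸ maximalIdeal R)) →ₗ[R] (MvPolynomial (Fin s) R ⧸ I) :=
    LinearMap.coprod (Algebra.linearMap R _) g2
  have hg : ∀ a u, g (a, u) = algebraMap R _ a + g2 u := fun a u => rfl
  have hg2 : ∀ i, g2 (Pi.single i 1) = Ideal.Quotient.mk I (MvPolynomial.X i) := by
    intro i
    have h1 : g2 (Pi.single i 1) = resLift _ (hm i) 1 := by
      exact LinearMap.lsum_piSingle ..
    rw [h1, ← map_one (Ideal.Quotient.mk _), resLift_mk, one_smul]
  have hspan : ∀ u : Fin s → R ⧸ maximalIdeal R, ∃ r : Fin s → R,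
      u = ∑ i, r i • Pi.single i 1 := by
    intro u
    choose r hr using fun i => Ideal.Quotient.mk_surjective (u i)
    refine ⟨r, ?_⟩
    funext k
    rw [Finset.sum_apply, Finset.sum_eq_single k]
    · rw [Pi.smul_apply, Pi.single_eq_same, Algebra.smul_def, mul_one, ← hr]; rfl
    · intro l _ hl; rw [Pi.smul_apply, Pi.single_eq_of_ne hl.symm, smul_zero]
    · simp
  have hfb : ∀ i, fb (Ideal.Quotient.mk I (MvPolynomial.X i)) = e i := by
    intro i
    change f _ = _
    exact MvPolynomial.aeval_X _ _
  have hsum : ∀ (r : Fin s → R) (t : Finset (Fin s)), ∑ i ∈ t, r i • e i =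
      ((0, ∑ i ∈ t, r i • Pi.single i 1) : R × (Fin s → R ⧸ maximalIdeal R)) := by
    intro r t
    induction t using Finset.induction_on with
    | empty => rfl
    | insert a t ha ih =>
      rw [Finset.sum_insert ha, Finset.sum_insert ha, ih]
      apply ExtRing.ext'
      · change r a * 0 + 0 = 0
        rw [mul_zero, add_zero]
      · rfl
  have hinj : Function.Injective g := by
    have hleft : ∀ x, fb (g x) = x := by
      rintro ⟨a, u⟩
      obtain ⟨r, rfl⟩ := hspan u
      have : g (a, ∑ i, r i • Pi.single i 1) = algebraMap R _ a +
          ∑ i, r i • Ideal.Quotient.mk I (MvPolynomial.X i) := by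
        rw [hg, map_sum]
        simp only [map_smul, hg2]
      rw [this, map_add, AlgHom.commutes, map_sum]
      simp only [map_smul, hfb]
      rw [hsum, ExtRing.algebraMap_eq]
      apply ExtRing.ext'
      · exact add_zero a
      · exact zero_add _
    exact Function.LeftInverse.injective hleft
  have hX : ∀ i, Ideal.Quotient.mk I (MvPolynomial.X i) ∈ LinearMap.range g := by
    intro i
    refine ⟨(0, Pi.single i 1), ?_⟩
    rw [hg, hg2, map_zero, zero_add]
  have hC : ∀ a, algebraMap R (MvPolynomial (Fin s) R ⧸ I) a ∈ LinearMap.range g := by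
    intro a
    refine ⟨(a, 0), ?_⟩
    rw [hg]
    rw [map_zero, add_zero]
  have hXX : ∀ i j, Ideal.Quotient.mk I (MvPolynomial.X i) * Ideal.Quotient.mk I (MvPolynomial.X j)
      = algebraMap R _ (c i j * ξ) := by
    intro i j
    have : MvPolynomial.X i * MvPolynomial.X j - MvPolynomial.C (c i j * ξ) ∈ I := by
      rw [hI]; exact Ideal.subset_span (Or.inl ⟨i, j, rfl⟩)
    rw [← Ideal.Quotient.eq_zero_iff_mem, map_sub, map_mul, sub_eq_zero] at this
    exact this
  have hsurj : Function.Surjective g := by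
    intro y
    obtain ⟨p, rfl⟩ := Ideal.Quotient.mk_surjective y
    change _ ∈ LinearMap.range g
    induction p using MvPolynomial.induction_on with
    | C a => exact hC a
    | add p q hp hq => rw [map_add]; exact add_mem hp hq
    | mul_X p i hp =>
      obtain ⟨⟨a, u⟩, h⟩ := hp
      obtain ⟨r, rfl⟩ := hspan u
      have h2 : g (a, ∑ i, r i • Pi.single i 1) = algebraMap R _ a +
          ∑ i, r i • Ideal.Quotient.mk I (MvPolynomial.X i) := by
        rw [hg, map_sum]
        simp only [map_smul, hg2]
      rw [map_mul, ← h, h2, add_mul, ← Algebra.smul_def, Finset.sum_mul]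
      refine add_mem (Submodule.smul_mem _ _ (hX i)) (Submodule.sum_mem _ fun j _ => ?_)
      rw [smul_mul_assoc, hXX]
      exact Submodule.smul_mem _ _ (hC _)
  exact ⟨LinearEquiv.ofBijective g ⟨hinj, hsurj⟩⟩

end Main

/-- Let `(R, m)` be an Artinian local ring containing a field `K` such that the composite
`K → R → R/m` is bijective, with `R ≠ K` (the inclusion `K → R` is not surjective), and
let `ξ ∈ m` satisfy `R·ξ = (0 :_R m)` (the socle of `R`). Let `s ≥ 1` and let
`c = (c_{ij})` be a symmetric `s × s` matrix over `K`. In `S = R[X₁, …, X_s]`, let `I` be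
the ideal generated by the `X_i·X_j − c_{ij}·ξ` together with `m·(X₁, …, X_s)`. Then
`ℓ_R(S/I) = ℓ_R(R) + s`. -/
theorem length_quotient_eq_length_add {R : Type*} [CommRing R] [IsArtinianRing R]
    [IsLocalRing R] (K : Type*) [Field K] [Algebra K R]
    (hbij : Function.Bijective ((Ideal.Quotient.mk (maximalIdeal R)).comp (algebraMap K R)))
    (hne : ¬ Function.Surjective (algebraMap K R))
    (ξ : R) (hξm : ξ ∈ maximalIdeal R)
    (hξ : Ideal.span {ξ} = Submodule.torsionBySet R R ↑(maximalIdeal R))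
    (s : ℕ) (hs : 1 ≤ s) (c : Matrix (Fin s) (Fin s) K) (hc : c.IsSymm) :
    moduleLength R (MvPolynomial (Fin s) R ⧸ Ideal.span
        ({p : MvPolynomial (Fin s) R | ∃ i j : Fin s,
            p = MvPolynomial.X i * MvPolynomial.X j
              - MvPolynomial.C (algebraMap K R (c i j) * ξ)} ∪
         {p : MvPolynomial (Fin s) R | ∃ a ∈ maximalIdeal R, ∃ i : Fin s,
            p = MvPolynomial.C a * MvPolynomial.X i})) =
      moduleLength R R + (s : WithBot ℕ∞) := by
  have hx : ∀ r ∈ maximalIdeal R, r • ξ = 0 := by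
    intro r hr
    have h : ξ ∈ Submodule.torsionBySet R R ↑(maximalIdeal R) := by
      rw [← hξ]; exact Ideal.mem_span_singleton_self ξ
    exact (Submodule.mem_torsionBySet_iff _ _).1 h ⟨r, hr⟩
  obtain ⟨E⟩ := main_equiv ξ hξm hx (fun i j => algebraMap K R (c i j))
    (fun i j => by rw [hc.apply]) _ rfl
  unfold moduleLength
  rw [← Module.coe_length, ← Module.coe_length, ← E.length_eq, Module.length_prod,
    Module.length_pi]
  have h1 : Module.length R (R ⧸ maximalIdeal R) = 1 := by
    rw [Module.length_eq_one_iff, isSimpleModule_iff_isCoatom]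
    exact (maximalIdeal.isMaximal R).out
  simp [h1]
end

section
/- Let A = A₀ ⊕ A₁ be a ℤ/2ℤ-graded commutative ring such that (A₀, m₀) is a Noetherian local ring of Krull dimension d, A₁ is a nonzero finitely generated A₀-module, and x·y ∈ m₀ for all x, y ∈ A₁, so that A is a Noetherian local ring with maximal ideal m₀ ⊕ A₁. Let q be the ideal of A₀ generated by all products x·y with x, y ∈ A₁. Then A is a regular local ring if and only if d = μ_{A₀}(m₀/q) + μ_{A₀}(A₁). In particular, if A is regular then 1 ≤ μ_{A₀}(A₁) ≤ d, and if d = 0 then A is never regular. -/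
open IsLocalRing

/-- The minimal number of generators `μ_R(M)` of an `R`-module `M`: the least cardinality
of a finite generating set. -/
noncomputable def minGen (R M : Type*) [Semiring R] [AddCommMonoid M] [Module R M] : ℕ :=
  sInf {n : ℕ | ∃ s : Finset M, s.card = n ∧ Submodule.span R (s : Set M) = ⊤}

open TensorProduct

lemma minGen_le_of_finset {R M : Type*} [Semiring R] [AddCommMonoid M] [Module R M]
    (s : Finset M) (hs : Submodule.span R (s : Set M) = ⊤) : minGen R M ≤ s.card :=
  Nat.sInf_le ⟨s, rfl, hs⟩

lemma exists_finset_minGen (R M : Type*) [Semiring R] [AddCommMonoid M] [Module R M]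
    [h : Module.Finite R M] :
    ∃ s : Finset M, s.card = minGen R M ∧ Submodule.span R (s : Set M) = ⊤ := by
  obtain ⟨s, hs⟩ := h.fg_top
  exact Nat.sInf_mem (s := {n : ℕ | ∃ s : Finset M, s.card = n ∧
    Submodule.span R (s : Set M) = ⊤}) ⟨_, s, rfl, hs⟩

lemma minGen_le_finrank (R M : Type*) [CommRing R] [IsLocalRing R] [AddCommGroup M] [Module R M]
    [Module.Finite R M] :
    minGen R M ≤ Module.finrank (ResidueField R) (ResidueField R ⊗[R] M) := by
  classical
  let b := Module.finBasis (ResidueField R) (ResidueField R ⊗[R] M)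
  have hsur : Function.Surjective (TensorProduct.mk R (ResidueField R) M 1) :=
    TensorProduct.mk_surjective R M _ Ideal.Quotient.mk_surjective
  choose f hf using fun i => hsur (b i)
  have := IsLocalRing.span_eq_top_of_tmul_eq_basis f b hf
  calc minGen R M ≤ (Finset.univ.image f).card := by
        apply minGen_le_of_finset; simpa using this
    _ ≤ _ := by simpa using Finset.card_image_le (s := Finset.univ) (f := f)

lemma ringKrullDim_eq_of_integral_inj (R S : Type*) [CommRing R] [CommRing S] [Algebra R S]
    [Algebra.IsIntegral R S] [FaithfulSMul R S] : ringKrullDim S = ringKrullDim R := by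
  apply le_antisymm
  · refine Order.krullDim_le_of_strictMono (PrimeSpectrum.comap (algebraMap R S)) ?_
    intro p q hpq
    exact Ideal.IsIntegral.comap_lt_comap (R := R) (I := p.asIdeal) (J := q.asIdeal) hpq
  · refine iSup_le fun l => ?_
    obtain ⟨P, hP, hPl⟩ := Ideal.exists_ideal_over_prime_of_isIntegral (S := S)
      (l.head.asIdeal) ⊥ (by
        intro x hx
        have : x = 0 := by
          apply FaithfulSMul.algebraMap_injective R S
          simpa using hx
        simp [this])
    obtain ⟨hP, hPl⟩ := hPl
    have : P.LiesOver (RelSeries.head l).asIdeal := ⟨hPl.symm⟩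
    obtain ⟨L, hL, -⟩ := Ideal.exists_ltSeries_of_hasGoingUp l P
    rw [← hL]
    exact le_iSup (fun l : LTSeries (PrimeSpectrum S) => (l.length : WithBot ℕ∞)) L

section
variable {A : Type*} [CommRing A] (A₀ : Subring A) (A₁ : Submodule A₀ A)

lemma graded_equiv 
    (hdisj : A₀.toAddSubgroup ⊓ A₁.toAddSubgroup = ⊥)
    (hspan : A₀.toAddSubgroup ⊔ A₁.toAddSubgroup = ⊤) :
    ∃ e : (A₀ × A₁) ≃ₗ[A₀] A, ∀ a x, e (a, x) = (a : A) + x := by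
  refine ⟨LinearEquiv.ofBijective (LinearMap.coprod (Algebra.linearMap A₀ A) A₁.subtype)
    ⟨?_, ?_⟩, fun a x => ?_⟩
  · rw [injective_iff_map_eq_zero]
    rintro ⟨a, x⟩ h
    have h' : (a : A) + x = 0 := h
    have h2 : (x : A) ∈ A₀.toAddSubgroup ⊓ A₁.toAddSubgroup := by
      refine ⟨?_, x.2⟩
      rw [eq_neg_of_add_eq_zero_right h']
      exact A₀.neg_mem a.2
    rw [hdisj] at h2
    have h3 : (x : A) = 0 := h2
    rw [h3, add_zero] at h'
    ext
    · exact h'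
    · exact h3
  · intro z
    have : z ∈ A₀.toAddSubgroup ⊔ A₁.toAddSubgroup := by rw [hspan]; trivial
    obtain ⟨a, ha, x, hx, rfl⟩ := AddSubgroup.mem_sup.1 this
    exact ⟨(⟨a, ha⟩, ⟨x, hx⟩), rfl⟩
  · rfl

variable [IsNoetherianRing A₀] [IsLocalRing A₀] [IsLocalRing A]

lemma graded_minGen
    (hgr : ∀ x ∈ A₁, ∀ y ∈ A₁, x * y ∈ A₀)
    (e : (A₀ × A₁) ≃ₗ[A₀] A) (he : ∀ a x, e (a, x) = (a : A) + x)
    [Module.Finite A₀ A₁] [Module.Finite A (maximalIdeal A)]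
    (hmem : ∀ a x, (e (a, x)) ∈ maximalIdeal A ↔ a ∈ maximalIdeal A₀) :
    minGen A (maximalIdeal A) = minGen A₀ (↥(maximalIdeal A₀) ⧸ Submodule.comap (maximalIdeal A₀).subtype
            (Ideal.span {a : A₀ | ∃ x ∈ A₁, ∃ y ∈ A₁, (a : A) = x * y})) + minGen A₀ A₁ := by
  classical
  set q := Ideal.span {a : A₀ | ∃ x ∈ A₁, ∃ y ∈ A₁, (a : A) = x * y} with hq
  have hA1m : ∀ x ∈ A₁, x ∈ maximalIdeal A := fun x hx => by
    have := (hmem 0 ⟨x, hx⟩).2 (zero_mem _)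
    rw [he] at this; simpa using this
  have hA0m : ∀ a : A₀, a ∈ maximalIdeal A₀ → (a : A) ∈ maximalIdeal A := fun a ha => by
    have := (hmem a 0).2 ha
    rw [he] at this; simpa using this
  apply le_antisymm
  · obtain ⟨S, hSc, hS⟩ := exists_finset_minGen A₀ (↥(maximalIdeal A₀) ⧸ Submodule.comap
      (maximalIdeal A₀).subtype q)
    obtain ⟨T, hTc, hT⟩ := exists_finset_minGen A₀ A₁
    rw [← hSc, ← hTc]
    let f : (↥(maximalIdeal A₀) ⧸ Submodule.comap
      (maximalIdeal A₀).subtype q) → maximalIdeal A := fun u => ⟨_, hA0m _ (Quotient.out u).2⟩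
    let g : A₁ → maximalIdeal A := fun x => ⟨x, hA1m _ x.2⟩
    refine le_trans (minGen_le_of_finset (S.image f ∪ T.image g) ?_)
      ((Finset.card_union_le _ _).trans
        (add_le_add Finset.card_image_le Finset.card_image_le))
    set W := Submodule.span A ((S.image f ∪ T.image g : Finset (maximalIdeal A)) :
      Set (maximalIdeal A)) with hW
    have h1 : ∀ x (hx : x ∈ A₁), (⟨x, hA1m x hx⟩ : maximalIdeal A) ∈ W := by
      intro x hx
      have h : (⟨x, hx⟩ : A₁) ∈ Submodule.span A₀ (T : Set A₁) := by rw [hT]; trivial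
      have : ∀ y ∈ Submodule.span A₀ (T : Set A₁), g y ∈ W := by
        intro y hy
        induction hy using Submodule.span_induction with
        | mem y hy => exact Submodule.subset_span (by simp; exact Or.inr ⟨y, y.2, hy, rfl⟩)
        | zero => exact W.zero_mem
        | add y z _ _ hy hz => exact W.add_mem hy hz
        | smul a y _ hy => exact W.smul_mem (a : A) hy
      exact this _ h
    have hqm : ∀ a ∈ q, ∀ h : (a : A) ∈ maximalIdeal A, (⟨a, h⟩ : maximalIdeal A) ∈ W := by
      intro a ha
      have : (a : A) ∈ W.map (maximalIdeal A).subtype := by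
        induction ha using Submodule.span_induction with
        | mem y hy =>
          obtain ⟨x, hx, z, hz, h⟩ := hy
          rw [h]
          exact ((W.map (maximalIdeal A).subtype).smul_mem x ⟨_, h1 z hz, rfl⟩)
        | zero => exact Submodule.zero_mem _
        | add y z _ _ hy hz => exact Submodule.add_mem _ hy hz
        | smul a y _ hy => exact Submodule.smul_mem _ (a : A) hy
      intro h
      obtain ⟨w, hw, hwa⟩ := this
      have : w = ⟨a, h⟩ := Subtype.ext hwa
      rwa [← this]
    have h0 : ∀ a (ha : a ∈ maximalIdeal A₀), (⟨a, hA0m a ha⟩ : maximalIdeal A) ∈ W := by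
      have key : ∀ u ∈ Submodule.span A₀ (S : Set (↥(maximalIdeal A₀) ⧸ Submodule.comap
          (maximalIdeal A₀).subtype q)), ∀ a : maximalIdeal A₀, Submodule.Quotient.mk a = u →
          (⟨a, hA0m a a.2⟩ : maximalIdeal A) ∈ W := by
        intro u hu
        induction hu using Submodule.span_induction with
        | mem u hu =>
          intro a hau
          have h2 : f u ∈ W := Submodule.subset_span (by
            simp only [Finset.coe_union, Finset.coe_image]
            exact Or.inl ⟨u, hu, rfl⟩)
          have h3 : a - Quotient.out u ∈ Submodule.comap (maximalIdeal A₀).subtype q := by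
            rw [← Submodule.Quotient.eq, hau]
            exact (Quotient.out_eq u).symm
          have h4 := hqm _ h3 (hA0m _ (a - Quotient.out u).2)
          have := W.add_mem h2 h4
          convert this using 1
          ext
          simp [f]
        | zero =>
          intro a ha
          exact hqm a (Submodule.mem_comap.1
            ((Submodule.Quotient.mk_eq_zero (Submodule.comap (maximalIdeal A₀).subtype q)).1 ha)) _
        | add u v _ _ hu hv =>
          intro a ha
          obtain ⟨b, rfl⟩ := Submodule.Quotient.mk_surjective _ u
          obtain ⟨c, rfl⟩ := Submodule.Quotient.mk_surjective _ v
          have h3 : a - (b + c) ∈ Submodule.comap (maximalIdeal A₀).subtype q := by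
            rw [← Submodule.Quotient.eq, ha]; rfl
          have h4 := hqm _ h3 (hA0m _ (a - (b + c)).2)
          have := W.add_mem (W.add_mem (hu b rfl) (hv c rfl)) h4
          convert this using 1
          ext
          simp
        | smul r u _ hu =>
          intro a ha
          obtain ⟨b, rfl⟩ := Submodule.Quotient.mk_surjective _ u
          have h3 : a - r • b ∈ Submodule.comap (maximalIdeal A₀).subtype q := by
            rw [← Submodule.Quotient.eq, ha]; rfl
          have h4 := hqm _ h3 (hA0m _ (a - r • b).2)
          have := W.add_mem (W.smul_mem (r : A) (hu b rfl)) h4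
          convert this using 1
          ext
          simp
      intro a ha
      exact key (Submodule.Quotient.mk ⟨a, ha⟩) (by rw [hS]; trivial) ⟨a, ha⟩ rfl
    rw [eq_top_iff]
    rintro ⟨z, hz⟩ -
    obtain ⟨⟨a, x⟩, rfl⟩ := e.surjective z
    have := W.add_mem (h0 a ((hmem _ _).1 hz)) (h1 x x.2)
    convert this using 1
    ext
    simp [he]
  · obtain ⟨S, hSc, hS⟩ := exists_finset_minGen A (maximalIdeal A)
    rw [← hSc]
    set Q := (↥(maximalIdeal A₀) ⧸ Submodule.comap (maximalIdeal A₀).subtype q)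
    set κ := ResidueField A₀
    have hm0 : ∀ z : maximalIdeal A, (e.symm z).1 ∈ maximalIdeal A₀ := fun z => by
      rw [← hmem _ (e.symm z).2]; simp
    let p0 : maximalIdeal A → maximalIdeal A₀ := fun z => ⟨(e.symm z).1, hm0 z⟩
    let φ : maximalIdeal A → (κ ⊗[A₀] Q) × (κ ⊗[A₀] A₁) := fun z =>
      (1 ⊗ₜ (Submodule.Quotient.mk (p0 z)), 1 ⊗ₜ (e.symm z).2)
    have φadd : ∀ z w, φ (z + w) = φ z + φ w := by
      intro z w
      have : p0 (z + w) = p0 z + p0 w := by ext; simp [p0]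
      simp only [φ, this]
      simp [TensorProduct.tmul_add]
    have φsmul : ∀ (a : A) z, φ (a • z) = (residue A₀ (e.symm a).1) • φ z := by
      intro a z
      obtain ⟨⟨a, x⟩, rfl⟩ := e.surjective a
      obtain ⟨z, hz⟩ := z
      obtain ⟨⟨b, y⟩, rfl⟩ := e.surjective z
      have hb := (hmem _ _).1 hz
      have hmul : e (a, x) * e (b, y) = e (a * b + ⟨x * y, hgr _ x.2 _ y.2⟩, a • y + b • x) := by
        simp only [he]
        simp [Subring.smul_def]
        ring
      have h1 : (Submodule.Quotient.mk (p0 ((e (a, x)) • ⟨_, hz⟩)) : Q)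
          = a • Submodule.Quotient.mk (p0 ⟨_, hz⟩) := by
        rw [← Submodule.Quotient.mk_smul]
        refine (Submodule.Quotient.eq _).2 ?_
        have : ((p0 ((e (a, x)) • ⟨_, hz⟩) - a • p0 ⟨_, hz⟩ : maximalIdeal A₀) : A₀)
            = ⟨x * y, hgr _ x.2 _ y.2⟩ := by
          simp [p0, hmul]
        rw [Submodule.mem_comap, Submodule.subtype_apply, this]
        exact Ideal.subset_span ⟨x, x.2, y, y.2, rfl⟩
      have h2 : (e.symm ((e (a, x)) • (⟨_, hz⟩ : maximalIdeal A) : maximalIdeal A)).2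
          = a • y + b • x := by simp [hmul]
      have h3 : residue A₀ b = 0 := (residue_eq_zero_iff b).2 hb
      have h4 : ∀ (c : A₀) (t : κ ⊗[A₀] Q), c • t = residue A₀ c • t :=
        fun c t => algebra_compatible_smul κ c t
      have h5 : ∀ (c : A₀) (t : κ ⊗[A₀] A₁), c • t = residue A₀ c • t :=
        fun c t => algebra_compatible_smul κ c t
      simp only [φ]
      rw [h1, h2, TensorProduct.tmul_add]
      ext
      · simp only [TensorProduct.tmul_smul, h4, Prod.smul_mk, LinearEquiv.symm_apply_apply]
      · simp only [TensorProduct.tmul_smul, h5, Prod.smul_mk, LinearEquiv.symm_apply_apply, h3,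
          zero_smul, add_zero]
    have φsurj : Function.Surjective φ := by
      rintro ⟨u, v⟩
      obtain ⟨u, rfl⟩ := TensorProduct.mk_surjective A₀ Q κ Ideal.Quotient.mk_surjective u
      obtain ⟨v, rfl⟩ := TensorProduct.mk_surjective A₀ A₁ κ Ideal.Quotient.mk_surjective v
      obtain ⟨b, rfl⟩ := Submodule.Quotient.mk_surjective _ u
      refine ⟨⟨e (b, v), (hmem _ _).2 b.2⟩, ?_⟩
      simp [φ, p0]
    have hspan : Submodule.span κ ((S.image φ : Finset _) : Set ((κ ⊗[A₀] Q) × (κ ⊗[A₀] A₁))) = ⊤ := by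
      rw [eq_top_iff]
      rintro w -
      obtain ⟨z, rfl⟩ := φsurj w
      have hz : z ∈ Submodule.span A (S : Set (maximalIdeal A)) := by rw [hS]; trivial
      induction hz using Submodule.span_induction with
      | mem z hz => exact Submodule.subset_span (Finset.mem_coe.2 (Finset.mem_image_of_mem φ hz))
      | zero =>
        have : φ 0 = 0 := by simpa using φadd 0 0
        rw [this]; exact Submodule.zero_mem _
      | add y z _ _ hy hz => rw [φadd]; exact Submodule.add_mem _ hy hz
      | smul a y _ hy => rw [φsmul]; exact Submodule.smul_mem _ _ hy
    calc _ ≤ Module.finrank κ (κ ⊗[A₀] Q) + Module.finrank κ (κ ⊗[A₀] A₁) :=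
          add_le_add (minGen_le_finrank _ _) (minGen_le_finrank _ _)
      _ = Module.finrank κ ((κ ⊗[A₀] Q) × (κ ⊗[A₀] A₁)) := Module.finrank_prod.symm
      _ ≤ (S.image φ).card := by
          rw [← finrank_top κ, ← hspan]
          exact finrank_span_finset_le_card _
      _ ≤ _ := Finset.card_image_le
end

/-- Let `A = A₀ ⊕ A₁` be a `ℤ/2ℤ`-graded commutative ring (`A₀` a subring, `A₁` an
`A₀`-submodule, `A = A₀ ⊕ A₁` additively, `A₁·A₁ ⊆ A₀`) with `(A₀, m₀)` a Noetherian
local ring of Krull dimension `d`, `A₁` a nonzero finitely generated `A₀`-module, and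
`x·y ∈ m₀` for all `x, y ∈ A₁`, so that `A` is a Noetherian local ring with maximal ideal
`m₀ ⊕ A₁`. Let `q ⊆ A₀` be the ideal generated by all products `x·y` with `x, y ∈ A₁`.
Then `A` is regular (i.e. `dim A` equals the minimal number of generators of its maximal
ideal) iff `d = μ_{A₀}(m₀/q) + μ_{A₀}(A₁)`. In particular, if `A` is regular then
`1 ≤ μ_{A₀}(A₁) ≤ d`, and if `d = 0` then `A` is never regular. -/
theorem regular_iff_of_z2graded {A : Type*} [CommRing A]
    (A₀ : Subring A) (A₁ : Submodule A₀ A)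
    [IsNoetherianRing A₀] [IsLocalRing A₀]
    (d : ℕ) (hd : ringKrullDim A₀ = d)
    (hgr : ∀ x ∈ A₁, ∀ y ∈ A₁, x * y ∈ A₀)
    (hdisj : A₀.toAddSubgroup ⊓ A₁.toAddSubgroup = ⊥)
    (hspan : A₀.toAddSubgroup ⊔ A₁.toAddSubgroup = ⊤)
    (hA₁ne : A₁ ≠ ⊥) (hA₁fg : A₁.FG)
    (hm : ∀ x ∈ A₁, ∀ y ∈ A₁, ∀ h : x * y ∈ A₀, (⟨x * y, h⟩ : A₀) ∈ maximalIdeal A₀)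
    [IsNoetherianRing A] [IsLocalRing A] :
    ((ringKrullDim A = (minGen A (maximalIdeal A) : WithBot ℕ∞)) ↔
        d = minGen A₀ (↥(maximalIdeal A₀) ⧸ Submodule.comap (maximalIdeal A₀).subtype
            (Ideal.span {a : A₀ | ∃ x ∈ A₁, ∃ y ∈ A₁, (a : A) = x * y})) + minGen A₀ A₁) ∧
    (ringKrullDim A = (minGen A (maximalIdeal A) : WithBot ℕ∞) →
        1 ≤ minGen A₀ A₁ ∧ minGen A₀ A₁ ≤ d) ∧
    (d = 0 → ringKrullDim A ≠ (minGen A (maximalIdeal A) : WithBot ℕ∞)) := by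
  obtain ⟨e, he⟩ := graded_equiv A₀ A₁ hdisj hspan
  have : Module.Finite A₀ A₁ := Module.Finite.iff_fg.2 hA₁fg
  have : Module.Finite A₀ A := Module.Finite.equiv e
  have hdim : ringKrullDim A = d := by rw [ringKrullDim_eq_of_integral_inj A₀ A, hd]
  have hloc : ∀ a : A₀, (a : A) ∈ maximalIdeal A ↔ a ∈ maximalIdeal A₀ := by
    intro a
    rw [mem_maximalIdeal, mem_maximalIdeal, mem_nonunits_iff, mem_nonunits_iff, not_iff_not]
    exact isUnit_map_iff (algebraMap A₀ A) a
  have hA1m : ∀ x ∈ A₁, x ∈ maximalIdeal A := by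
    intro x hx
    have h := (hloc ⟨x * x, hgr x hx x hx⟩).2 (hm x hx x hx _)
    exact (or_self_iff).1 ((maximalIdeal.isMaximal A).isPrime.mem_or_mem h)
  have hmem : ∀ a x, (e (a, x)) ∈ maximalIdeal A ↔ a ∈ maximalIdeal A₀ := by
    intro a x
    rw [he, Submodule.add_mem_iff_left _ (hA1m x x.2), hloc]
  have hmin := graded_minGen A₀ A₁ hgr e he hmem
  have hpos : 1 ≤ minGen A₀ A₁ := by
    by_contra hlt
    obtain ⟨s, hs, hst⟩ := exists_finset_minGen A₀ A₁
    have : s = ∅ := by rw [← Finset.card_eq_zero]; omega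
    subst this
    apply hA₁ne
    rw [Finset.coe_empty, Submodule.span_empty] at hst
    rw [← Submodule.subsingleton_iff_eq_bot]
    exact (Submodule.subsingleton_iff A₀).1 (subsingleton_of_bot_eq_top hst)
  have hiff : ringKrullDim A = (minGen A (maximalIdeal A) : WithBot ℕ∞) ↔
      d = minGen A (maximalIdeal A) := by
    rw [hdim]; exact_mod_cast Iff.rfl
  rw [hiff, hmin]
  refine ⟨Iff.rfl, fun h => ⟨hpos, ?_⟩, fun h1 h2 => ?_⟩
  · omega
  · rw [← hmin, hiff] at h2
    omega
end

section
/- Let A = A₀ ⊕ A₁ be a ℤ/2ℤ-graded commutative ring such that (A₀, m₀) is a Noetherian local ring, A₁ is a nonzero finitely generated A₀-module, and x·y ∈ m₀ for all x, y ∈ A₁, so that A is a Noetherian local ring. Let q be the ideal of A₀ generated by all products x·y with x, y ∈ A₁. If A is a regular local ring, then: (1) A₀ is a Cohen–Macaulay local domain; (2) A₀/q is a regular local ring; (3) A₁ is a maximal Cohen–Macaulay A₀-module and A₁ is isomorphic as an A₀-module to an ideal of A₀. -/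
open IsLocalRing

section Aux
open IsLocalRing RingTheory.Sequence
open scoped Pointwise

universe uu

theorem aux_cancel (a : ℕ) (b : WithBot ℕ∞) (k : ℕ)
    (h : ((a + k : ℕ) : WithBot ℕ∞) ≤ b + (k : WithBot ℕ∞)) : (a : WithBot ℕ∞) ≤ b := by
  induction b with
  | bot => simp at h
  | coe b =>
    induction b with
    | top => exact WithBot.coe_le_coe.mpr le_top
    | coe b =>
      have h' : a + k ≤ b + k := by exact_mod_cast h
      exact_mod_cast (by omega : a ≤ b)

theorem aux_cancel_eq (a : ℕ) (b : WithBot ℕ∞) (k : ℕ)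
    (h : b + (k : WithBot ℕ∞) = ((a + k : ℕ) : WithBot ℕ∞)) : b = a := by
  refine le_antisymm ?_ (aux_cancel a b k h.ge)
  induction b with
  | bot => simp
  | coe b =>
    induction b with
    | top =>
      exfalso
      have h1 : (((⊤ : ℕ∞) + (k : ℕ∞) : ℕ∞) : WithBot ℕ∞) = (((a + k : ℕ) : ℕ∞) : WithBot ℕ∞) := by
        exact_mod_cast h
      rw [WithBot.coe_inj, top_add] at h1
      exact ENat.top_ne_natCast _ h1
    | coe b =>
      have h' : b + k = a + k := by exact_mod_cast h
      exact_mod_cast (by omega : b ≤ a)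

theorem aux_exists_gens {R : Type uu} [CommRing R] [IsLocalRing R] [IsNoetherianRing R]
    (S T₀ : Set (maximalIdeal R)) (hS : Submodule.span R S = ⊤) (hT : T₀ ⊆ S)
    (hli : LinearIndepOn (ResidueField R)
      (fun x => ((maximalIdeal R).toCotangent x : CotangentSpace R)) T₀) :
    ∃ T : Finset (maximalIdeal R), (T : Set (maximalIdeal R)) ⊆ S ∧ T₀ ⊆ T ∧
      T.card = (maximalIdeal R).spanFinrank ∧ Submodule.span R (T : Set (maximalIdeal R)) = ⊤ := by
  obtain ⟨b, hbS, hTb, hsp, hb⟩ := exists_linearIndepOn_extension hli hT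
  have hfin : b.Finite := by
    have : LinearIndependent (ResidueField R) (fun x : b => ((maximalIdeal R).toCotangent x.1 : CotangentSpace R)) := hb
    have := this.finite
    exact Set.toFinite b
  have h1 : Submodule.span (ResidueField R) ((maximalIdeal R).toCotangent '' b) =
      (⊤ : Submodule (ResidueField R) (CotangentSpace R)) := by
    rw [← CotangentSpace.span_image_eq_top_iff] at hS
    rw [eq_top_iff, ← hS]
    exact Submodule.span_le.mpr hsp
  refine ⟨hfin.toFinset, by simpa using hbS, by simpa using hTb, ?_, ?_⟩
  · rw [spanFinrank_maximalIdeal_eq_finrank_cotangentSpace]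
    let B : Module.Basis b (ResidueField R) (CotangentSpace R) := Module.Basis.mk hb (by
      rw [← h1, Set.image_eq_range])
    rw [Module.finrank_eq_nat_card_basis B, Nat.card_coe_set_eq, Set.ncard_eq_toFinset_card b hfin]
  · rw [Set.Finite.coe_toFinset]
    exact CotangentSpace.span_image_eq_top_iff.mp h1

theorem aux_span_coe {R : Type uu} [CommRing R] (I : Ideal R) (T : Set I) :
    Submodule.span R T = ⊤ ↔ Ideal.span ((↑) '' T : Set R) = I := by
  have h : Ideal.span ((↑) '' T : Set R) = (Submodule.span R T).map I.subtype := by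
    rw [Submodule.map_span]; rfl
  rw [h]
  constructor
  · intro h; rw [h]; simp
  · intro h
    apply Submodule.map_injective_of_injective I.injective_subtype
    rw [h]; simp

theorem aux_minGen {R : Type uu} [CommRing R] (I : Ideal R) (hI : I.FG) :
    minGen R I = I.spanFinrank := by
  have hfg : (⊤ : Submodule R I).FG := (Submodule.fg_top I).mpr hI
  obtain ⟨s, hs, hs'⟩ := hfg.exists_span_finset_card_eq_spanFinrank
  rw [Submodule.spanFinrank_top] at hs
  apply le_antisymm
  · exact Nat.sInf_le ⟨s, hs, hs'⟩
  · unfold minGen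
    refine le_csInf ⟨s.card, s, rfl, hs'⟩ ?_
    rintro n ⟨t, rfl, ht⟩
    rw [← Submodule.spanFinrank_top, ← ht]
    simpa using Submodule.spanFinrank_span_le_ncard_of_finite (R := R) t.finite_toSet

theorem aux_map_max {R : Type uu} [CommRing R] [IsLocalRing R] (I : Ideal R)
    [IsLocalRing (R ⧸ I)] :
    maximalIdeal (R ⧸ I) = (maximalIdeal R).map (Ideal.Quotient.mk I) := by
  have := ((local_hom_TFAE (Ideal.Quotient.mk I)).out 0 4).mp
    (IsLocalHom.of_surjective _ Ideal.Quotient.mk_surjective)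
  rw [← this, Ideal.map_comap_of_surjective _ Ideal.Quotient.mk_surjective]

theorem aux_quot_regular {R : Type uu} [CommRing R] [IsLocalRing R] [IsNoetherianRing R]
    (h : IsRegularLocalRing R) (x : R) (hx : x ∈ maximalIdeal R) (hx2 : x ∉ (maximalIdeal R) ^ 2) :
    IsRegularLocalRing (R ⧸ Ideal.span {x}) ∧
    (maximalIdeal R).spanFinrank = ringKrullDim (R ⧸ Ideal.span {x}) + 1 := by
  have hne : Ideal.span {x} ≠ ⊤ := fun h => by
    rw [Ideal.span_singleton_eq_top] at h; exact hx h
  have : Nontrivial (R ⧸ Ideal.span {x}) := Ideal.Quotient.nontrivial_iff.mpr hne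
  have : IsLocalRing (R ⧸ Ideal.span {x}) :=
    IsLocalRing.of_surjective' (Ideal.Quotient.mk _) Ideal.Quotient.mk_surjective
  have hli : LinearIndepOn (ResidueField R)
      (fun x => ((maximalIdeal R).toCotangent x : CotangentSpace R)) {⟨x, hx⟩} := by
    apply LinearIndepOn.singleton
    simpa [Ideal.toCotangent_eq_zero] using hx2
  obtain ⟨T, -, hT, hc, hsp⟩ := aux_exists_gens Set.univ {⟨x, hx⟩} (by simp) (by simp) hli
  classical
  rw [aux_span_coe] at hsp
  have hxT : (⟨x, hx⟩ : maximalIdeal R) ∈ T := by simpa using hT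
  let T' := (T.erase ⟨x, hx⟩).image (fun t => Ideal.Quotient.mk (Ideal.span {x}) t.1)
  have hT' : Ideal.span (T' : Set (R ⧸ Ideal.span {x})) = maximalIdeal _ := by
    rw [aux_map_max, ← hsp, Ideal.map_span]
    apply le_antisymm
    · apply Ideal.span_mono
      intro y hy
      simp only [T', Finset.coe_image, Set.mem_image, Finset.mem_coe, Finset.mem_erase] at hy ⊢
      obtain ⟨t, ht, rfl⟩ := hy
      exact ⟨t, ⟨t, ht.2, rfl⟩, rfl⟩
    · rw [Ideal.span_le]
      rintro _ ⟨_, ⟨t, ht, rfl⟩, rfl⟩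
      by_cases htx : t = ⟨x, hx⟩
      · subst htx
        have : Ideal.Quotient.mk (Ideal.span {x}) x = 0 :=
          Ideal.Quotient.eq_zero_iff_mem.mpr (Ideal.mem_span_singleton_self x)
        simp [this]
      · apply Ideal.subset_span
        simp only [T', Finset.coe_image, Set.mem_image, Finset.mem_coe, Finset.mem_erase]
        exact ⟨t, ⟨htx, ht⟩, rfl⟩
  have hcard : T'.card + 1 ≤ (maximalIdeal R).spanFinrank := by
    rw [← hc, ← Finset.card_erase_add_one hxT]
    gcongr
    exact Finset.card_image_le
  have h1 : (maximalIdeal (R ⧸ Ideal.span {x})).spanFinrank ≤ T'.card := by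
    rw [← hT']
    simpa using Submodule.spanFinrank_span_le_ncard_of_finite (R := R ⧸ Ideal.span {x}) T'.finite_toSet
  have h2 : ringKrullDim R ≤ ringKrullDim (R ⧸ Ideal.span {x}) + 1 := by
    have := ringKrullDim_le_ringKrullDim_quotient_add_card ({x} : Finset R)
      (by simpa [IsLocalRing.ringJacobson_eq_maximalIdeal] using hx)
    rw [Finset.coe_singleton] at this
    simpa using this
  have h3 := ringKrullDim_le_spanFinrank_maximalIdeal (R ⧸ Ideal.span {x})
  have h4 := (isRegularLocalRing_iff R).mp h
  rw [← h4] at h2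
  have h5 : ((maximalIdeal (R ⧸ Ideal.span {x})).spanFinrank : WithBot ℕ∞) + 1 ≤ (maximalIdeal R).spanFinrank := by
    exact_mod_cast (by omega : (maximalIdeal (R ⧸ Ideal.span {x})).spanFinrank + 1 ≤ (maximalIdeal R).spanFinrank)
  have h6 := h5.trans h2
  refine ⟨.of_spanFinrank_maximalIdeal_le _ ?_, le_antisymm h2 ?_⟩
  · exact aux_cancel _ _ 1 (by exact_mod_cast h6)
  · exact le_trans (by gcongr) h5

theorem aux_domain (n : ℕ) : ∀ (R : Type uu) [CommRing R] [IsRegularLocalRing R],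
    (maximalIdeal R).spanFinrank = n → IsDomain R := by
  induction n with
  | zero =>
    intro R _ _ h
    have hM : maximalIdeal R = ⊥ :=
      (Submodule.spanFinrank_eq_zero_iff_eq_bot (IsNoetherian.noetherian _)).mp h
    have := (IsLocalRing.isField_iff_maximalIdeal_eq).mpr hM
    exact this.isDomain
  | succ n ih =>
    intro R _ hR h
    have hdim := (isRegularLocalRing_iff R).mp hR
    have hM0 : maximalIdeal R ≠ ⊥ := by
      intro hb; rw [hb] at h; simp at h
    have hex : ∃ x ∈ maximalIdeal R, x ∉ (maximalIdeal R)^2 ∧ ∀ p ∈ minimalPrimes R, x ∉ p := by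
      by_contra! hcon
      have hsub : ((maximalIdeal R : Ideal R) : Set R) ⊆
          ⋃ i ∈ insert ((maximalIdeal R)^2) (minimalPrimes R), ((id i : Ideal R) : Set R) := by
        intro x hx
        by_cases h2 : x ∈ (maximalIdeal R)^2
        · exact Set.mem_biUnion (Set.mem_insert _ _) h2
        · obtain ⟨p, hp, hxp⟩ := hcon x hx h2
          exact Set.mem_biUnion (Set.mem_insert_of_mem _ hp) hxp
      rw [Ideal.subset_union_prime_finite
        ((minimalPrimes.finite_of_isNoetherianRing R).insert _) ((maximalIdeal R)^2) ((maximalIdeal R)^2)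
        (by
          rintro i (rfl | hi) h1 h2
          · exact absurd rfl h1
          · exact hi.1.1)] at hsub
      obtain ⟨i, (rfl | hi), hle⟩ := hsub
      · apply hM0
        apply Submodule.eq_bot_of_le_smul_of_le_jacobson_bot (maximalIdeal R) _ (IsNoetherian.noetherian _)
        · rw [smul_eq_mul, ← pow_two]; exact hle
        · exact maximalIdeal_le_jacobson _
      · have hip : i.IsPrime := hi.1.1
        have : i = maximalIdeal R := le_antisymm (le_maximalIdeal hip.ne_top) hle
        subst this
        have h0 := Ideal.height_eq_zero_iff.mpr hi
        have := IsLocalRing.maximalIdeal_height_eq_ringKrullDim (R := R)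
        rw [h0, ← hdim, h] at this
        have h3 : (0 : ℕ) = n + 1 := by exact_mod_cast this
        omega
    obtain ⟨x, hx, hx2, hxp⟩ := hex
    obtain ⟨hreg, hd⟩ := aux_quot_regular hR x hx hx2
    have hdom : IsDomain (R ⧸ Ideal.span {x}) := by
      apply ih
      have := (isRegularLocalRing_iff _).mp hreg
      rw [← this, h] at hd
      have : n + 1 = (maximalIdeal (R ⧸ Ideal.span {x})).spanFinrank + 1 := by exact_mod_cast hd
      omega
    have hpr : (Ideal.span {x}).IsPrime := (Ideal.Quotient.isDomain_iff_prime _).mp hdom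
    obtain ⟨p, hp, hle⟩ := Ideal.exists_minimalPrimes_le (I := ⊥) (J := Ideal.span {x}) bot_le
    have hpp : p.IsPrime := hp.1.1
    have hpb : p = ⊥ := by
      apply Submodule.eq_bot_of_le_smul_of_le_jacobson_bot (maximalIdeal R) _ (IsNoetherian.noetherian _)
      · intro z hz
        obtain ⟨c, rfl⟩ := Ideal.mem_span_singleton'.mp (hle hz)
        have : c ∈ p := (hpp.mem_or_mem hz).resolve_right (hxp p hp)
        rw [mul_comm]
        exact Ideal.mul_mem_mul hx this
      · exact maximalIdeal_le_jacobson _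
    subst hpb
    exact IsDomain.of_bot_isPrime R

theorem aux_isWeaklyRegular (n : ℕ) : ∀ (R : Type uu) [CommRing R] [IsLocalRing R]
    [IsNoetherianRing R] (l : List R), l.length = n → Ideal.ofList l = maximalIdeal R →
    ringKrullDim R = n → IsWeaklyRegular R l := by
  classical
  induction n with
  | zero =>
    intro R _ _ _ l hl _ _
    rw [List.length_eq_zero_iff] at hl
    subst hl
    exact .nil R R
  | succ n ih =>
    intro R _ _ _ l hl hM hd
    have hle : ∀ l : List R, (Ideal.ofList l).spanFinrank ≤ l.length := by
      intro l
      have h1 : {r | r ∈ l} = (l.toFinset : Set R) := by ext; simp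
      have := Submodule.spanFinrank_span_le_ncard_of_finite (R := R) l.toFinset.finite_toSet
      rw [Set.ncard_coe_finset] at this
      have h2 := this.trans l.toFinset_card_le
      rwa [← h1] at h2
    have hreg : IsRegularLocalRing R := by
      apply IsRegularLocalRing.of_spanFinrank_maximalIdeal_le
      rw [← hM, hd, ← hl]
      exact_mod_cast hle l
    have hdom : IsDomain R := aux_domain _ R rfl
    obtain ⟨x, t, rfl⟩ := List.exists_cons_of_length_eq_add_one hl
    have htl : t.length = n := by simpa using hl
    have hx : x ∈ maximalIdeal R := by
      rw [← hM]; exact Ideal.subset_span (by simp)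
    have hx0 : x ≠ 0 := by
      rintro rfl
      have h1 : Ideal.ofList t = maximalIdeal R := by
        rw [← hM]; simp
      have h2 := ringKrullDim_le_spanFinrank_maximalIdeal R
      rw [hd, ← h1] at h2
      have h3 := hle t
      have h4 : n + 1 ≤ (Ideal.ofList t).spanFinrank := by exact_mod_cast h2
      omega
    have hxr : IsSMulRegular R x := fun a b hab => mul_left_cancel₀ hx0 hab
    have hne : Ideal.span {x} ≠ ⊤ := fun h => by
      rw [Ideal.span_singleton_eq_top] at h; exact hx h
    have : Nontrivial (R ⧸ Ideal.span {x}) := Ideal.Quotient.nontrivial_iff.mpr hne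
    have : IsLocalRing (R ⧸ Ideal.span {x}) :=
      IsLocalRing.of_surjective' (Ideal.Quotient.mk _) Ideal.Quotient.mk_surjective
    rw [isWeaklyRegular_cons_iff]
    refine ⟨hxr, ?_⟩
    have key : IsWeaklyRegular (R ⧸ Ideal.span {x}) (t.map (algebraMap R (R ⧸ Ideal.span {x}))) := by
      apply ih
      · simpa using htl
      · rw [aux_map_max, ← hM, Ideal.map_ofList]
        have : Ideal.Quotient.mk (Ideal.span {x}) x = 0 :=
          Ideal.Quotient.eq_zero_iff_mem.mpr (Ideal.mem_span_singleton_self x)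
        simp [this]
      · have := ringKrullDim_quotient_span_singleton_succ_eq_ringKrullDim hxr hx
        rw [hd] at this
        exact aux_cancel_eq _ _ 1 (by exact_mod_cast this)
    rw [isWeaklyRegular_map_algebraMap_iff] at key
    have heq : x • (⊤ : Ideal R) = Ideal.span {x} := by simp [← Submodule.ideal_span_singleton_smul]
    exact ((Submodule.quotEquivOfEq _ _ heq).isWeaklyRegular_congr t).mpr key

theorem aux_sq {R : Type uu} [CommRing R] [IsLocalRing R] [IsNoetherianRing R] (l₂ : List R) :
    ∀ l₁ : List R, (∀ r ∈ l₁ ++ l₂, r ∈ maximalIdeal R) → IsWeaklyRegular R (l₁ ++ l₂) →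
    IsWeaklyRegular R (l₁ ++ l₂.map (fun x => x ^ 2)) := by
  induction l₂ with
  | nil => intro l₁ _ h; simpa using h
  | cons a t ih =>
    intro l₁ hm h
    have h1 : IsWeaklyRegular R ((l₁ ++ t) ++ [a]) := by
      refine IsLocalRing.isWeaklyRegular_of_perm_of_subset_maximalIdeal h ?_ hm
      rw [List.append_assoc]
      exact List.Perm.append_left _ (List.perm_append_singleton a t).symm
    have h2 : IsWeaklyRegular R ((l₁ ++ t) ++ [a ^ 2]) := by
      rw [isWeaklyRegular_append_iff, isWeaklyRegular_singleton_iff] at h1 ⊢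
      exact ⟨h1.1, h1.2.pow 2⟩
    have ham : a ∈ maximalIdeal R := hm a (by simp)
    have hm2 : ∀ r ∈ (l₁ ++ t) ++ [a ^ 2], r ∈ maximalIdeal R := by
      intro r hr
      simp only [List.mem_append, List.mem_singleton] at hr
      rcases hr with (hr | hr) | rfl
      · exact hm r (by simp [hr])
      · exact hm r (by simp [hr])
      · exact Ideal.pow_mem_of_mem _ ham 2 (by norm_num)
    have hp : List.Perm ((l₁ ++ t) ++ [a ^ 2]) ((l₁ ++ [a ^ 2]) ++ t) := by
      rw [List.append_assoc, List.append_assoc]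
      exact List.Perm.append_left _ List.perm_append_comm
    have h3 := IsLocalRing.isWeaklyRegular_of_perm_of_subset_maximalIdeal h2 hp hm2
    have h4 := ih (l₁ ++ [a ^ 2]) (fun r hr => hm2 r (hp.mem_iff.mpr hr)) h3
    simpa using h4

theorem aux_retract {R : Type uu} [CommRing R] (rs : List R) : ∀ {M N : Type uu}
    [AddCommGroup M] [Module R M] [AddCommGroup N] [Module R N] (i : N →ₗ[R] M) (p : M →ₗ[R] N),
    p ∘ₗ i = LinearMap.id → IsWeaklyRegular M rs → IsWeaklyRegular N rs := by
  induction rs with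
  | nil => intros; exact .nil R _
  | cons r rs ih =>
    intro M N _ _ _ _ i p hpi h
    rw [isWeaklyRegular_cons_iff] at h ⊢
    have hinj : Function.Injective i := by
      intro a b hab
      have := congrArg p hab
      have h1 : ∀ x, p (i x) = x := fun x => LinearMap.congr_fun hpi x
      rwa [h1, h1] at this
    refine ⟨?_, ih (QuotSMulTop.map r i) (QuotSMulTop.map r p) ?_ h.2⟩
    · intro a b hab
      apply hinj
      apply h.1
      simpa using congrArg i hab
    · rw [← QuotSMulTop.map_comp, hpi, QuotSMulTop.map_id]

theorem aux_depth {R M : Type*} [CommRing R] [IsLocalRing R] [IsNoetherianRing R]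
    [AddCommGroup M] [Module R M] [Module.Finite R M] [Nontrivial M] (rs : List R)
    (hm : ∀ r ∈ rs, r ∈ maximalIdeal R) (h : IsWeaklyRegular M rs)
    (hd : ringKrullDim R ≤ rs.length) : (moduleDepth R M : WithBot ℕ∞) = ringKrullDim R := by
  have key : ∀ l : List R, IsRegular M l → (l.length : WithBot ℕ∞) ≤ ringKrullDim R := by
    intro l hl
    have h1 := Module.supportDim_add_length_eq_supportDim_of_isRegular l hl
    have h2 : Nontrivial (M ⧸ (Ideal.ofList l • (⊤ : Submodule R M))) :=
      hl.quot_ofList_smul_nontrivial ⊤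
    have h3 : 0 ≤ Module.supportDim R (M ⧸ (Ideal.ofList l • (⊤ : Submodule R M))) := by
      have := (Module.supportDim_ne_bot_iff_nontrivial R
        (M ⧸ (Ideal.ofList l • (⊤ : Submodule R M)))).mpr h2
      obtain ⟨n, hn⟩ := WithBot.ne_bot_iff_exists.mp this
      rw [← hn]
      exact WithBot.coe_le_coe.mpr zero_le
    refine le_trans ?_ (Module.supportDim_le_ringKrullDim R M)
    rw [← h1]
    exact le_add_of_nonneg_left h3
  have hreg : IsRegular M rs := .of_isWeaklyRegular_of_mem_maximalIdeal M hm h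
  have hdim : ringKrullDim R = rs.length := le_antisymm hd (key rs hreg)
  have : moduleDepth R M = rs.length := by
    apply le_antisymm
    · apply sSup_le
      rintro _ ⟨l, rfl, -, hl⟩
      have := key l hl
      rw [hdim] at this
      exact_mod_cast this
    · exact le_sSup ⟨rs, rfl, hm, hreg⟩
  rw [this, hdim]; rfl

theorem aux_proj {A : Type uu} [CommRing A]
    (A₀ : Subring A) (A₁ : Submodule A₀ A)
    (hdisj : A₀.toAddSubgroup ⊓ A₁.toAddSubgroup = ⊥)
    (hspan : A₀.toAddSubgroup ⊔ A₁.toAddSubgroup = ⊤) :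
    ∃ (e : (A₀ × A₁) ≃ₗ[A₀] A), ∀ a y, e (a, y) = (a : A) + y := by
  let f : (A₀ × A₁) →ₗ[A₀] A := (Algebra.linearMap A₀ A).coprod A₁.subtype
  have hf : ∀ a y, f (a, y) = (a : A) + y := fun a y => by
    simp [f]; rfl
  refine ⟨LinearEquiv.ofBijective f ⟨?_, ?_⟩, hf⟩
  · rw [injective_iff_map_eq_zero]
    rintro ⟨a, y⟩ h
    rw [hf] at h
    have h1 : (a : A) ∈ A₀.toAddSubgroup ⊓ A₁.toAddSubgroup := by
      refine ⟨a.2, ?_⟩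
      rw [eq_neg_of_add_eq_zero_left h]
      exact A₁.neg_mem y.2
    rw [hdisj, AddSubgroup.mem_bot] at h1
    rw [h1, zero_add] at h
    ext
    · exact h1
    · exact h
  · intro z
    have : z ∈ A₀.toAddSubgroup ⊔ A₁.toAddSubgroup := by rw [hspan]; trivial
    obtain ⟨a, ha, y, hy, rfl⟩ := AddSubgroup.mem_sup.mp this
    exact ⟨(⟨a, ha⟩, ⟨y, hy⟩), hf _ _⟩

theorem aux_main {A : Type uu} [CommRing A]
    (A₀ : Subring A) (A₁ : Submodule A₀ A)
    [IsNoetherianRing A₀] [IsLocalRing A₀]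
    (hgr : ∀ x ∈ A₁, ∀ y ∈ A₁, x * y ∈ A₀)
    (hdisj : A₀.toAddSubgroup ⊓ A₁.toAddSubgroup = ⊥)
    (hspan : A₀.toAddSubgroup ⊔ A₁.toAddSubgroup = ⊤)
    (hA₁ne : A₁ ≠ ⊥) (hA₁fg : A₁.FG)
    (hm : ∀ x ∈ A₁, ∀ y ∈ A₁, ∀ h : x * y ∈ A₀, (⟨x * y, h⟩ : A₀) ∈ maximalIdeal A₀)
    [IsNoetherianRing A] [IsLocalRing A]
    (hreg : ringKrullDim A = (minGen A (maximalIdeal A) : WithBot ℕ∞))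
    (q : Ideal A₀) (hq : q = Ideal.span {a : A₀ | ∃ x ∈ A₁, ∃ y ∈ A₁, (a : A) = x * y}) :
    (IsDomain A₀ ∧ ringKrullDim A₀ = (moduleDepth A₀ A₀ : WithBot ℕ∞)) ∧
    (IsLocalRing (A₀ ⧸ q) ∧
      ∀ n : Ideal (A₀ ⧸ q),
        n.IsMaximal →
        ringKrullDim (A₀ ⧸ q) =
          (minGen (A₀ ⧸ q) n : WithBot ℕ∞)) ∧
    ((moduleDepth A₀ A₁ : WithBot ℕ∞) = ringKrullDim A₀ ∧
      ∃ J : Ideal A₀, Nonempty (A₁ ≃ₗ[A₀] J)) := by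
  classical
  -- projections
  obtain ⟨e, he⟩ := aux_proj A₀ A₁ hdisj hspan
  let p₀ : A →ₗ[A₀] A₀ := LinearMap.fst A₀ A₀ A₁ ∘ₗ e.symm.toLinearMap
  let p₁ : A →ₗ[A₀] A₁ := LinearMap.snd A₀ A₀ A₁ ∘ₗ e.symm.toLinearMap
  have hp : ∀ z, (p₀ z : A) + p₁ z = z := fun z => by
    rw [← he]; exact e.apply_symm_apply z
  have hp₀ : ∀ (a : A₀) (y : A₁), p₀ ((a : A) + y) = a := fun a y => by
    rw [← he]; simp [p₀]
  have hp₁ : ∀ (a : A₀) (y : A₁), p₁ ((a : A) + y) = y := fun a y => by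
    rw [← he]; simp [p₁]
  have h00 : ∀ a : A₀, p₀ (a : A) = a := fun a => by simpa using hp₀ a 0
  have h01 : ∀ a : A₀, p₁ (a : A) = 0 := fun a => by simpa using hp₁ a 0
  have h10 : ∀ a : A₁, p₀ (a : A) = 0 := fun a => by simpa using hp₀ 0 a
  have h11 : ∀ a : A₁, p₁ (a : A) = a := fun a => by simpa using hp₁ 0 a
  have hmul : ∀ (a : A₀) (y : A₁), (a : A) * y ∈ A₁ := fun a y => A₁.smul_mem a y.2
  have hmulz : ∀ c z : A, c * z =
      ((p₀ c * p₀ z + ⟨p₁ c * p₁ z, hgr _ (p₁ c).2 _ (p₁ z).2⟩ : A₀) : A) +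
      ((p₀ c • p₁ z + p₀ z • p₁ c : A₁) : A) := fun c z => by
    conv_lhs => rw [← hp c, ← hp z]
    simp only [Subring.coe_add, Subring.coe_mul, Submodule.coe_add, Submodule.coe_smul,
      Subring.smul_def, smul_eq_mul]
    ring
  -- finiteness
  have hfin₁ : Module.Finite A₀ A₁ := Module.Finite.iff_fg.mpr hA₁fg
  have hfin : Module.Finite A₀ A := Module.Finite.equiv e
  have hint : Algebra.IsIntegral A₀ A := inferInstance
  have hntA₁ : Nontrivial A₁ := Submodule.nontrivial_iff_ne_bot.mpr hA₁ne
  -- maximal ideals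
  have hmM : ∀ a : A₀, a ∈ maximalIdeal A₀ ↔ (a : A) ∈ maximalIdeal A := by
    intro a
    rw [mem_maximalIdeal, mem_maximalIdeal, mem_nonunits_iff, mem_nonunits_iff, not_iff_not]
    constructor
    · intro h; exact h.map A₀.subtype
    · intro h
      obtain ⟨b, hb⟩ := h.exists_right_inv
      refine IsUnit.of_mul_eq_one (p₀ b) ?_
      have := congrArg p₀ hb
      rw [hmulz, hp₀, h00, h01] at this
      have h1 : p₀ (1 : A) = 1 := by simpa using h00 1
      rw [h1] at this
      rw [← this]
      ext; simp
  have hA₁M : ∀ y : A₁, (y : A) ∈ maximalIdeal A := by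
    intro y
    have h1 : (y : A) * y ∈ maximalIdeal A :=
      (hmM ⟨y * y, hgr _ y.2 _ y.2⟩).mp (hm _ y.2 _ y.2 _)
    exact ((inferInstance : (maximalIdeal A).IsPrime).mem_or_mem h1).elim id id
  have hp₀M : ∀ z ∈ maximalIdeal A, p₀ z ∈ maximalIdeal A₀ := by
    intro z hz
    rw [hmM]
    have : (p₀ z : A) = z - p₁ z := by rw [eq_sub_iff_add_eq]; exact hp z
    rw [this]
    exact sub_mem hz (hA₁M _)
  -- q is inside the maximal ideal
  have hqmem : ∀ x y : A₁, (⟨x * y, hgr _ x.2 _ y.2⟩ : A₀) ∈ q := by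
    intro x y
    rw [hq]
    exact Ideal.subset_span ⟨x, x.2, y, y.2, rfl⟩
  have hqm : q ≤ maximalIdeal A₀ := by
    rw [hq, Ideal.span_le]
    rintro a ⟨x, hx, y, hy, hxy⟩
    have : a = ⟨x * y, hgr _ hx _ hy⟩ := Subtype.ext hxy
    rw [this]
    exact hm _ hx _ hy _
  -- regularity of A
  have hMfg : (maximalIdeal A).FG := IsNoetherian.noetherian _
  rw [aux_minGen _ hMfg] at hreg
  have hAreg : IsRegularLocalRing A := (isRegularLocalRing_iff A).mpr hreg.symm
  have hAdom : IsDomain A := aux_domain _ A rfl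
  -- homogeneous generators
  obtain ⟨T, hTS, -, hTc, hTsp⟩ := aux_exists_gens (R := A)
    {z | (z : A) ∈ A₀ ∨ (z : A) ∈ A₁} ∅ (by
      rw [eq_top_iff]
      rintro z -
      have h1 : (p₀ z.1 : A) ∈ maximalIdeal A := (hmM _).mp (hp₀M _ z.2)
      have : z = (⟨p₀ z.1, h1⟩ : maximalIdeal A) + ⟨p₁ z.1, hA₁M _⟩ := Subtype.ext (hp z.1).symm
      rw [this]
      exact add_mem (Submodule.subset_span (Or.inl (p₀ z.1).2))
        (Submodule.subset_span (Or.inr (p₁ z.1).2))) (by simp) (by simp)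
  rw [aux_span_coe] at hTsp
  rw [← hTc] at hreg
  -- the list of squares
  let l : List A := T.toList.map (fun t => t.1)
  have hlT : ∀ r, r ∈ l ↔ ∃ t ∈ T, (t : A) = r := by intro r; simp [l]
  have hlM : Ideal.ofList l = maximalIdeal A := by
    rw [← hTsp]
    refine congrArg Ideal.span (Set.ext fun r => ?_)
    exact hlT r
  have hlen : l.length = T.card := by simp [l]
  have hlm : ∀ r ∈ l, r ∈ maximalIdeal A := by
    intro r hr
    obtain ⟨t, -, rfl⟩ := (hlT r).mp hr
    exact t.2
  have hwreg : IsWeaklyRegular A l := aux_isWeaklyRegular T.card A l hlen hlM hreg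
  have hwreg2 : IsWeaklyRegular A (l.map (fun x => x ^ 2)) := by
    simpa using aux_sq l [] (by simpa using hlm) (by simpa using hwreg)
  have hsqA₀ : ∀ r ∈ l, r ^ 2 ∈ A₀ := by
    intro r hr
    obtain ⟨t, ht, rfl⟩ := (hlT r).mp hr
    rcases hTS ht with h | h
    · exact pow_mem h 2
    · rw [pow_two]; exact hgr _ h _ h
  let rs : List A₀ := l.map (fun x => p₀ (x ^ 2))
  have hrs : rs.map (algebraMap A₀ A) = l.map (fun x => x ^ 2) := by
    simp only [rs, List.map_map]
    apply List.map_congr_left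
    intro r hr
    exact congrArg Subtype.val (h00 ⟨r ^ 2, hsqA₀ r hr⟩)
  have hrsval : ∀ r ∈ l, ((p₀ (r ^ 2) : A₀) : A) = r ^ 2 := fun r hr =>
    congrArg Subtype.val (h00 ⟨r ^ 2, hsqA₀ r hr⟩)
  have hrsreg : IsWeaklyRegular A rs := by
    rw [← isWeaklyRegular_map_algebraMap_iff A, hrs]; exact hwreg2
  have hrsm : ∀ r ∈ rs, r ∈ maximalIdeal A₀ := by
    intro r hr
    obtain ⟨x, hx, rfl⟩ := List.mem_map.mp hr
    exact hp₀M _ (Ideal.pow_mem_of_mem _ (hlm x hx) 2 (by norm_num))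
  have hrslen : rs.length = T.card := by simp [rs, hlen]
  have hreg₀ : IsWeaklyRegular A₀ rs :=
    aux_retract rs (Algebra.linearMap A₀ A) p₀ (LinearMap.ext fun a => h00 a) hrsreg
  have hreg₁ : IsWeaklyRegular A₁ rs :=
    aux_retract rs A₁.subtype p₁ (LinearMap.ext fun a => h11 a) hrsreg
  -- dimension of A₀
  have hdim₀ : ringKrullDim A₀ ≤ rs.length := by
    have hmin : maximalIdeal A₀ ∈ (Ideal.span (rs.toFinset : Set A₀)).minimalPrimes := by
      refine ⟨⟨inferInstance, ?_⟩, ?_⟩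
      · rw [Ideal.span_le]
        intro r hr
        exact hrsm r (by simpa using hr)
      · rintro P ⟨hP, hPle⟩ -
        obtain ⟨Q, -, hQ, hQP⟩ := Ideal.exists_ideal_over_prime_of_isIntegral (S := A) P ⊥ (by
          intro a ha
          have : a = 0 := by
            apply Subtype.ext
            simpa using ha
          rw [this]; exact P.zero_mem)
        have hMQ : maximalIdeal A ≤ Q := by
          rw [← hlM, Ideal.span_le]
          intro r hr
          have h1 : p₀ (r ^ 2) ∈ P := hPle (Ideal.subset_span (by
            simp only [List.coe_toFinset, Set.mem_ofPred_eq, rs]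
            exact List.mem_map.mpr ⟨r, hr, rfl⟩))
          rw [← hQP, Ideal.mem_comap] at h1
          have h2 : r ^ 2 ∈ Q := by
            rw [← hrsval r hr]; exact h1
          exact hQ.mem_of_pow_mem _ h2
        intro a ha
        rw [← hQP]
        exact hMQ ((hmM a).mp ha)
    have h1 := Ideal.height_le_card_of_mem_minimalPrimes_span_finset hmin
    have h2 := h1.trans (Nat.cast_le.mpr rs.toFinset_card_le)
    rw [← IsLocalRing.maximalIdeal_height_eq_ringKrullDim]
    exact_mod_cast h2
  -- generators of the pieces
  let X : Finset (maximalIdeal A) := T.filter (fun t : maximalIdeal A => (t : A) ∈ A₀)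
  let Y : Finset (maximalIdeal A) := T.filter (fun t : maximalIdeal A => ¬ (t : A) ∈ A₀)
  have hXY : X.card + Y.card = T.card := by
    have := Finset.card_filter_add_card_filter_not (s := T) (fun t : maximalIdeal A => (t : A) ∈ A₀)
    convert this
  have hYA : ∀ t : maximalIdeal A, t ∈ Y → (t : A) ∈ A₁ := by
    intro t ht
    obtain ⟨h1, h2⟩ := Finset.mem_filter.mp ht
    exact (hTS h1).resolve_left h2
  let X₀ : Finset A₀ := X.image (fun t => p₀ t.1)
  let Y₁ : Finset A := Y.image (fun t => t.1)
  let N : Submodule A₀ A := Submodule.span A₀ (Y₁ : Set A)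
  have hX₀m : Ideal.span (X₀ : Set A₀) ⊔ q ≤ maximalIdeal A₀ := by
    refine sup_le ?_ hqm
    rw [Ideal.span_le]
    intro a ha
    obtain ⟨t, -, rfl⟩ := Finset.mem_image.mp (Finset.mem_coe.mp ha)
    exact hp₀M _ t.2
  have hcomp : ∀ z ∈ maximalIdeal A, p₀ z ∈ Ideal.span (X₀ : Set A₀) ⊔ q ∧
      (p₁ z : A) ∈ N ⊔ maximalIdeal A₀ • A₁ := by
    intro z hz
    rw [← hTsp] at hz
    induction hz using Submodule.span_induction with
    | mem z hz =>
      obtain ⟨t, ht, rfl⟩ := hz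
      by_cases hA : (t : A) ∈ A₀
      · constructor
        · apply Ideal.mem_sup_left
          apply Ideal.subset_span
          exact Finset.mem_coe.mpr (Finset.mem_image.mpr ⟨t, Finset.mem_filter.mpr ⟨ht, hA⟩, rfl⟩)
        · have := h01 ⟨t, hA⟩
          simp only at this
          rw [this]; exact Submodule.zero_mem _
      · have htY : t ∈ Y := Finset.mem_filter.mpr ⟨ht, hA⟩
        have h1 := h10 ⟨t, hYA t htY⟩
        have h2 := h11 ⟨t, hYA t htY⟩
        simp only at h1 h2
        rw [h1, h2]
        refine ⟨Submodule.zero_mem _, Submodule.mem_sup_left (Submodule.subset_span ?_)⟩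
        exact Finset.mem_coe.mpr (Finset.mem_image.mpr ⟨t, htY, rfl⟩)
    | zero => simp
    | add x y _ _ hx hy =>
      rw [map_add, map_add]
      exact ⟨add_mem hx.1 hy.1, add_mem hx.2 hy.2⟩
    | smul c z _ hz =>
      rw [smul_eq_mul, hmulz c z, hp₀, hp₁]
      constructor
      · exact add_mem (Ideal.mul_mem_left _ _ hz.1) (Ideal.mem_sup_right (hqmem _ _))
      · rw [Submodule.coe_add]
        refine add_mem (Submodule.smul_mem _ _ hz.2) (Submodule.mem_sup_right ?_)
        exact Submodule.smul_mem_smul (hX₀m hz.1) (p₁ c).2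
  have hA₁N : A₁ ≤ N := by
    apply Submodule.le_of_le_smul_of_le_jacobson_bot (I := maximalIdeal A₀) hA₁fg
      (maximalIdeal_le_jacobson _)
    intro y hy
    have := (hcomp y (hA₁M ⟨y, hy⟩)).2
    rwa [h11 ⟨y, hy⟩] at this
  -- the quotient
  have hqne : q ≠ ⊤ := fun h => (Ideal.IsPrime.ne_top (inferInstance : (maximalIdeal A₀).IsPrime))
    (top_le_iff.mp (h ▸ hqm))
  have hntq : Nontrivial (A₀ ⧸ q) := Ideal.Quotient.nontrivial_iff.mpr hqne
  have hlocq : IsLocalRing (A₀ ⧸ q) :=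
    IsLocalRing.of_surjective' (Ideal.Quotient.mk _) Ideal.Quotient.mk_surjective
  let I : Ideal A := Ideal.span (Y₁ : Set A)
  have hNI : ∀ y ∈ A₁, y ∈ I := by
    intro y hy
    have h1 : N ≤ I.restrictScalars A₀ := Submodule.span_le.mpr Ideal.subset_span
    exact h1 (hA₁N hy)
  let φ : A₀ ⧸ q →+* A ⧸ I := Ideal.Quotient.lift q ((Ideal.Quotient.mk I).comp A₀.subtype) (by
    have : q ≤ RingHom.ker ((Ideal.Quotient.mk I).comp A₀.subtype) := by
      rw [hq, Ideal.span_le]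
      rintro a ⟨x, hx, y, hy, hxy⟩
      change Ideal.Quotient.mk I (a : A) = 0
      rw [hxy, Ideal.Quotient.eq_zero_iff_mem]
      exact I.mul_mem_left _ (hNI y hy)
    intro a ha
    exact this ha)
  have hφ : Function.Surjective φ := by
    intro z
    obtain ⟨z, rfl⟩ := Ideal.Quotient.mk_surjective z
    refine ⟨Ideal.Quotient.mk q (p₀ z), ?_⟩
    change Ideal.Quotient.mk I (p₀ z : A) = Ideal.Quotient.mk I z
    rw [Ideal.Quotient.eq]
    have : (p₀ z : A) - z = -(p₁ z : A) := by
      nth_rewrite 2 [← hp z]; ring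
    rw [this]
    exact neg_mem (hNI _ (p₁ z).2)
  have hdq1 : (X.card : WithBot ℕ∞) ≤ ringKrullDim (A₀ ⧸ q) := by
    have h1 := ringKrullDim_le_of_surjective φ hφ
    have h2 := ringKrullDim_le_ringKrullDim_quotient_add_card Y₁ (by
      rw [IsLocalRing.ringJacobson_eq_maximalIdeal]
      intro a ha
      obtain ⟨t, -, rfl⟩ := Finset.mem_image.mp (Finset.mem_coe.mp ha)
      exact t.2)
    have h3 : Y₁.card ≤ Y.card := Finset.card_image_le
    apply aux_cancel _ _ Y.card
    rw [hXY, ← hreg]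
    refine h2.trans (add_le_add h1 ?_)
    exact_mod_cast h3
  have hdq2 : (maximalIdeal (A₀ ⧸ q)).spanFinrank ≤ X.card := by
    let X' : Finset (A₀ ⧸ q) := X₀.image (Ideal.Quotient.mk q)
    have h1 : maximalIdeal (A₀ ⧸ q) = Ideal.span (X' : Set (A₀ ⧸ q)) := by
      rw [aux_map_max]
      have : maximalIdeal A₀ = Ideal.span (X₀ : Set A₀) ⊔ q := by
        refine le_antisymm ?_ hX₀m
        intro a ha
        have := (hcomp a ((hmM a).mp ha)).1
        rwa [h00] at this
      rw [this, Ideal.map_sup, Ideal.map_span, Ideal.map_quotient_self, sup_bot_eq]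
      simp [X']
    rw [h1]
    have h2 := Submodule.spanFinrank_span_le_ncard_of_finite (R := A₀ ⧸ q) X'.finite_toSet
    rw [Set.ncard_coe_finset] at h2
    exact h2.trans (Finset.card_image_le.trans Finset.card_image_le)
  have hdq3 := ringKrullDim_le_spanFinrank_maximalIdeal (A₀ ⧸ q)
  refine ⟨⟨inferInstance, ?_⟩, ⟨hlocq, ?_⟩, ?_, ?_⟩
  · exact (aux_depth rs hrsm hreg₀ hdim₀).symm
  · intro n hn
    have hnm : n = maximalIdeal (A₀ ⧸ q) := IsLocalRing.eq_maximalIdeal hn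
    rw [hnm, aux_minGen _ (IsNoetherian.noetherian _)]
    refine le_antisymm hdq3 (le_trans ?_ hdq1)
    exact_mod_cast hdq2
  · exact aux_depth rs hrsm hreg₁ hdim₀
  · obtain ⟨y, hy⟩ := exists_ne (0 : A₁)
    let f : A₁ →ₗ[A₀] A₀ := p₀ ∘ₗ (LinearMap.mulLeft A₀ (y : A)) ∘ₗ A₁.subtype
    have hf : ∀ z : A₁, (f z : A) = y * z := fun z =>
      congrArg Subtype.val (h00 ⟨y * z, hgr _ y.2 _ z.2⟩)
    have hfi : Function.Injective f := by
      intro a b hab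
      have h1 : (y : A) * a = y * b := by rw [← hf, ← hf, hab]
      have hy0 : (y : A) ≠ 0 := fun h => hy (Subtype.ext h)
      exact Subtype.ext (mul_left_cancel₀ hy0 h1)
    exact ⟨LinearMap.range f, ⟨LinearEquiv.ofInjective f hfi⟩⟩

end Aux

/-- Let `A = A₀ ⊕ A₁` be a `ℤ/2ℤ`-graded commutative ring (`A₀` a subring, `A₁` an
`A₀`-submodule, `A = A₀ ⊕ A₁` additively, `A₁·A₁ ⊆ A₀`) with `(A₀, m₀)` a Noetherian
local ring, `A₁` a nonzero finitely generated `A₀`-module, and `x·y ∈ m₀` for all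
`x, y ∈ A₁`, so that `A` is a Noetherian local ring. Let `q ⊆ A₀` be the ideal generated
by all products `x·y` with `x, y ∈ A₁`. If `A` is regular (i.e. `dim A = v(A)`), then:
(1) `A₀` is a Cohen–Macaulay (depth = dimension) domain;
(2) `A₀/q` is a regular local ring;
(3) `A₁` is a maximal Cohen–Macaulay `A₀`-module (`depth_{A₀} A₁ = dim A₀`) and `A₁` is
isomorphic as an `A₀`-module to an ideal of `A₀`. -/
theorem regular_consequences_of_z2graded {A : Type*} [CommRing A]
    (A₀ : Subring A) (A₁ : Submodule A₀ A)
    [IsNoetherianRing A₀] [IsLocalRing A₀]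
    (hgr : ∀ x ∈ A₁, ∀ y ∈ A₁, x * y ∈ A₀)
    (hdisj : A₀.toAddSubgroup ⊓ A₁.toAddSubgroup = ⊥)
    (hspan : A₀.toAddSubgroup ⊔ A₁.toAddSubgroup = ⊤)
    (hA₁ne : A₁ ≠ ⊥) (hA₁fg : A₁.FG)
    (hm : ∀ x ∈ A₁, ∀ y ∈ A₁, ∀ h : x * y ∈ A₀, (⟨x * y, h⟩ : A₀) ∈ maximalIdeal A₀)
    [IsNoetherianRing A] [IsLocalRing A]
    (hreg : ringKrullDim A = (minGen A (maximalIdeal A) : WithBot ℕ∞)) :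
    (IsDomain A₀ ∧ ringKrullDim A₀ = (moduleDepth A₀ A₀ : WithBot ℕ∞)) ∧
    (IsLocalRing (A₀ ⧸ Ideal.span {a : A₀ | ∃ x ∈ A₁, ∃ y ∈ A₁, (a : A) = x * y}) ∧
      ∀ n : Ideal (A₀ ⧸ Ideal.span {a : A₀ | ∃ x ∈ A₁, ∃ y ∈ A₁, (a : A) = x * y}),
        n.IsMaximal →
        ringKrullDim (A₀ ⧸ Ideal.span {a : A₀ | ∃ x ∈ A₁, ∃ y ∈ A₁, (a : A) = x * y}) =
          (minGen (A₀ ⧸ Ideal.span {a : A₀ | ∃ x ∈ A₁, ∃ y ∈ A₁, (a : A) = x * y}) n :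
            WithBot ℕ∞)) ∧
    ((moduleDepth A₀ A₁ : WithBot ℕ∞) = ringKrullDim A₀ ∧
      ∃ J : Ideal A₀, Nonempty (A₁ ≃ₗ[A₀] J)) := by
  exact aux_main A₀ A₁ hgr hdisj hspan hA₁ne hA₁fg hm hreg _ rfl
end

section
/- Let A = A₀ ⊕ A₁ be a ℤ/2ℤ-graded commutative ring such that (A₀, m₀) is a Noetherian local ring, A₁ is a nonzero finitely generated A₀-module with μ_{A₀}(A₁) = 1, and x·y ∈ m₀ for all x, y ∈ A₁, so that A is a Noetherian local ring. Then A is a regular local ring if and only if A₀ is a regular local ring, A₁ is a free A₀-module of rank one with basis element e, and e² ∉ m₀². -/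
open IsLocalRing

theorem minGen_eq_spanFinrank {R M : Type*} [Semiring R] [AddCommMonoid M] [Module R M]
    (p : Submodule R M) : minGen R p = p.spanFinrank := by
  rw [← Submodule.spanFinrank_top, Submodule.spanFinrank_eq_iInf, minGen, iInf]
  congr 1
  ext n
  simp only [Set.mem_setOf_eq, Set.mem_range, Subtype.exists]
  constructor
  · rintro ⟨s, h1, h2⟩
    exact ⟨s, h2, h1⟩
  · rintro ⟨s, h2, h1⟩
    exact ⟨s, h1, h2⟩

theorem map_max_of_surj {R S : Type*} [CommRing R] [CommRing S] [IsLocalRing R] [IsLocalRing S]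
    (f : R →+* S) (hf : Function.Surjective f) :
    (maximalIdeal R).map f = maximalIdeal S := by
  have hmax : (maximalIdeal S).comap f = maximalIdeal R :=
    IsLocalRing.eq_maximalIdeal (Ideal.comap_isMaximal_of_surjective f hf)
  rw [← hmax, Ideal.map_comap_of_surjective f hf]

theorem exists_lift_gens {R S : Type*} [CommRing R] [CommRing S] [IsLocalRing R] [IsLocalRing S]
    [IsNoetherianRing S]
    (f : R →+* S) (hf : Function.Surjective f) {x : R} (hk : RingHom.ker f = Ideal.span {x}) :
    ∃ s : Finset R, s.card ≤ (maximalIdeal S).spanFinrank ∧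
      Ideal.span (s : Set R) ⊔ Ideal.span {x} = maximalIdeal R := by
  classical
  obtain ⟨s, hs, hspan⟩ := Submodule.FG.exists_span_finset_card_eq_spanFinrank
    (IsNoetherian.noetherian (maximalIdeal S))
  choose g hg using hf
  refine ⟨s.image g, hs ▸ Finset.card_image_le, ?_⟩
  have hmap : (Ideal.span ((s.image g : Finset R) : Set R)).map f = maximalIdeal S := by
    rw [Ideal.map_span, Finset.coe_image, Set.image_image]
    simp only [hg, Set.image_id']
    exact hspan
  have hmax : (maximalIdeal S).comap f = maximalIdeal R :=
    IsLocalRing.eq_maximalIdeal (Ideal.comap_isMaximal_of_surjective f (fun y => ⟨g y, hg y⟩))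
  rw [← hmax, ← hmap, Ideal.comap_map_of_surjective' f (fun y => ⟨g y, hg y⟩), hk]

theorem v_le_add_one {R S : Type*} [CommRing R] [CommRing S] [IsLocalRing R] [IsLocalRing S]
    [IsNoetherianRing S]
    (f : R →+* S) (hf : Function.Surjective f) {x : R} (hk : RingHom.ker f = Ideal.span {x}) :
    (maximalIdeal R).spanFinrank ≤ (maximalIdeal S).spanFinrank + 1 := by
  classical
  obtain ⟨s, hs, hspan⟩ := exists_lift_gens f hf hk
  rw [← hspan, ← Ideal.span_union]
  refine (Submodule.spanFinrank_span_le_ncard_of_finite (by simp)).trans ?_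
  refine (Set.ncard_union_le _ _).trans ?_
  rw [Set.ncard_coe_finset, Set.ncard_singleton]
  omega

theorem v_le_of_mem_sq {R S : Type*} [CommRing R] [CommRing S] [IsLocalRing R] [IsLocalRing S]
    [IsNoetherianRing S] [IsNoetherianRing R]
    (f : R →+* S) (hf : Function.Surjective f) {x : R} (hk : RingHom.ker f = Ideal.span {x})
    (hx : x ∈ maximalIdeal R ^ 2) :
    (maximalIdeal R).spanFinrank ≤ (maximalIdeal S).spanFinrank := by
  obtain ⟨s, hs, hspan⟩ := exists_lift_gens f hf hk
  have h : Ideal.span (s : Set R) = maximalIdeal R := by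
    apply le_antisymm
    · rw [← hspan]; exact le_sup_left
    · refine Submodule.le_of_le_smul_of_le_jacobson_bot (I := maximalIdeal R)
        (IsNoetherian.noetherian _) (IsLocalRing.maximalIdeal_le_jacobson _) ?_
      conv_lhs => rw [← hspan]
      refine sup_le_sup_left ?_ _
      rw [Ideal.span_singleton_le_iff_mem, smul_eq_mul, ← pow_two]
      exact hx
  rw [← h]
  refine (Submodule.spanFinrank_span_le_ncard_of_finite (by simp)).trans ?_
  rwa [Set.ncard_coe_finset]

theorem v_add_one_le {R S : Type*} [CommRing R] [CommRing S] [IsLocalRing R] [IsLocalRing S]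
    [IsNoetherianRing R]
    (f : R →+* S) (hf : Function.Surjective f) {x : R} (hk : f x = 0)
    (hxm : x ∈ maximalIdeal R) (hx : x ∉ maximalIdeal R ^ 2) :
    (maximalIdeal S).spanFinrank + 1 ≤ (maximalIdeal R).spanFinrank := by
  classical
  obtain ⟨s, hs, hspan⟩ := Submodule.FG.exists_span_finset_card_eq_spanFinrank
    (IsNoetherian.noetherian (maximalIdeal R))
  have hxs : x ∈ Submodule.span R (s : Set R) := by rw [hspan]; exact hxm
  obtain ⟨c, -, hc⟩ := Submodule.mem_span_finset.1 hxs
  have : ∃ g ∈ s, c g ∉ maximalIdeal R := by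
    by_contra! hcon
    apply hx
    rw [← hc, pow_two]
    refine Ideal.sum_mem _ fun i hi => Ideal.mul_mem_mul (hcon i hi) ?_
    rw [← hspan]
    exact Submodule.subset_span hi
  obtain ⟨g, hg, hcg⟩ := this
  have hu : IsUnit (c g) := by simpa using hcg
  have hmem : f g ∈ Ideal.span ((s.erase g).image f : Set S) := by
    have h1 : f (c g) * f g = - ∑ i ∈ s.erase g, f (c i) * f i := by
      rw [← Finset.add_sum_erase _ _ hg] at hc
      have := congrArg f hc
      simp only [map_add, map_sum, smul_eq_mul, map_mul, hk] at this
      exact eq_neg_of_add_eq_zero_left this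
    rw [← Ideal.unit_mul_mem_iff_mem _ (hu.map f), h1]
    refine neg_mem (Ideal.sum_mem _ fun i hi => Ideal.mul_mem_left _ _ (Ideal.subset_span ?_))
    simp only [Finset.coe_image]
    exact ⟨i, hi, rfl⟩
  have hS : maximalIdeal S = Ideal.span ((s.erase g).image f : Set S) := by
    rw [← map_max_of_surj f hf, ← hspan]
    apply le_antisymm
    · change Ideal.map f (Ideal.span _) ≤ _
      rw [Ideal.map_span, Ideal.span_le]
      rintro _ ⟨i, hi, rfl⟩
      by_cases hig : i = g
      · rw [hig]; exact hmem
      · apply Ideal.subset_span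
        simp only [Finset.coe_image]
        exact ⟨i, Finset.mem_erase.2 ⟨hig, hi⟩, rfl⟩
    · change _ ≤ Ideal.map f (Ideal.span _)
      rw [Ideal.map_span]
      apply Ideal.span_mono
      simp only [Finset.coe_image]
      exact Set.image_mono (by simp)
  have h2 : (maximalIdeal S).spanFinrank ≤ (s.erase g).card := by
    rw [hS]
    refine (Submodule.spanFinrank_span_le_ncard_of_finite (Finset.finite_toSet _)).trans ?_
    rw [Set.ncard_coe_finset]
    exact Finset.card_image_le
  rw [Finset.card_erase_of_mem hg] at h2
  have : 0 < s.card := Finset.card_pos.2 ⟨g, hg⟩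
  omega

theorem isDomain_of_regular_aux (n : ℕ) : ∀ (R : Type*) [CommRing R] [IsRegularLocalRing R],
    (maximalIdeal R).spanFinrank = n → IsDomain R := by
  induction n with
  | zero =>
    intro R _ _ h
    rw [Submodule.spanFinrank_eq_zero_iff_eq_bot (IsNoetherian.noetherian _)] at h
    have := (IsLocalRing.isField_iff_maximalIdeal_eq).2 h
    exact this.isDomain
  | succ n ih =>
    intro R _ _ h
    have hreg := (isRegularLocalRing_iff R).1 inferInstance
    obtain ⟨x, hxm, hx2, hxp⟩ : ∃ x ∈ maximalIdeal R, x ∉ maximalIdeal R ^ 2 ∧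
        ∀ p ∈ minimalPrimes R, x ∉ p := by
      by_contra! hcon
      have hsub : (maximalIdeal R : Set R) ⊆
          ⋃ i ∈ insert (maximalIdeal R ^ 2) (minimalPrimes R), ((id i : Ideal R) : Set R) := by
        intro x hx
        by_cases hx2 : x ∈ maximalIdeal R ^ 2
        · exact Set.mem_biUnion (Set.mem_insert _ _) hx2
        · obtain ⟨p, hp, hxp⟩ := hcon x hx hx2
          exact Set.mem_biUnion (Set.mem_insert_of_mem _ hp) hxp
      rw [Ideal.subset_union_prime_finite ((minimalPrimes.finite_of_isNoetherianRing R).insert _)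
        (maximalIdeal R ^ 2) (maximalIdeal R ^ 2)] at hsub
      · obtain ⟨p, hp, hle⟩ := hsub
        rcases hp with rfl | hp
        · have : maximalIdeal R = ⊥ := by
            refine Submodule.eq_bot_of_le_smul_of_le_jacobson_bot (maximalIdeal R) _
              (IsNoetherian.noetherian _) ?_ (IsLocalRing.maximalIdeal_le_jacobson _)
            rw [smul_eq_mul, ← pow_two]
            exact hle
          rw [this, Submodule.spanFinrank_bot] at h
          omega
        · have hpp : p.IsPrime := hp.1.1
          have hpe : maximalIdeal R = p := le_antisymm hle (IsLocalRing.le_maximalIdeal hpp.ne_top)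
          have h0 : (maximalIdeal R).height = 0 := by
            rw [Ideal.height_eq_zero_iff, hpe]
            exact hp
          rw [← IsLocalRing.maximalIdeal_height_eq_ringKrullDim, h0, h] at hreg
          have : n + 1 = 0 := by exact_mod_cast hreg
          omega
      · rintro i (rfl | hi) h1 h2
        · exact absurd rfl h1
        · exact hi.1.1
    have hne : Ideal.span {x} ≠ (⊤ : Ideal R) := by
      rw [Ne, Ideal.span_singleton_eq_top]
      exact hxm
    have : Nontrivial (R ⧸ Ideal.span {x}) := Ideal.Quotient.nontrivial_iff.2 hne
    have : IsLocalRing (R ⧸ Ideal.span {x}) :=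
      .of_surjective' (Ideal.Quotient.mk _) Ideal.Quotient.mk_surjective
    have hv := v_add_one_le (Ideal.Quotient.mk (Ideal.span {x})) Ideal.Quotient.mk_surjective
      (x := x) (by simp [Ideal.Quotient.eq_zero_iff_mem, Ideal.mem_span_singleton_self]) hxm hx2
    have hd : ringKrullDim R ≤ ringKrullDim (R ⧸ Ideal.span {x}) + 1 := by
      rw [← IsLocalRing.maximalIdeal_height_eq_ringKrullDim]
      exact Ideal.height_le_ringKrullDim_quotient_add_one hxm
    have hd2 := ringKrullDim_le_spanFinrank_maximalIdeal (R ⧸ Ideal.span {x})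
    rw [← hreg, h] at hd
    rw [h] at hv
    have hd3 : (n : WithBot ℕ∞) ≤ ringKrullDim (R ⧸ Ideal.span {x}) := by
      by_contra! hlt
      have h1 := hd.trans (ENat.WithBot.add_one_le_natCast_iff.2 hlt)
      have h2 : n + 1 ≤ n := by exact_mod_cast h1
      omega
    have hr : IsRegularLocalRing (R ⧸ Ideal.span {x}) := by
      apply IsRegularLocalRing.of_spanFinrank_maximalIdeal_le
      refine le_trans ?_ hd3
      exact_mod_cast Nat.le_of_succ_le_succ hv
    have hvn : (maximalIdeal (R ⧸ Ideal.span {x})).spanFinrank = n := by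
      have : n ≤ (maximalIdeal (R ⧸ Ideal.span {x})).spanFinrank := by
        exact_mod_cast hd3.trans hd2
      omega
    have hdom := ih (R ⧸ Ideal.span {x}) hvn
    have hprime : (Ideal.span {x}).IsPrime := (Ideal.Quotient.isDomain_iff_prime _).1 hdom
    obtain ⟨p, hp, hple⟩ := Ideal.exists_minimalPrimes_le (I := ⊥) (J := Ideal.span {x}) bot_le
    have hpp : p.IsPrime := hp.1.1
    have hpx := hxp p hp
    have hpbot : p = ⊥ := by
      refine Submodule.eq_bot_of_le_smul_of_le_jacobson_bot (maximalIdeal R) _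
        (IsNoetherian.noetherian _) ?_ (IsLocalRing.maximalIdeal_le_jacobson _)
      intro y hy
      obtain ⟨z, rfl⟩ := Ideal.mem_span_singleton.1 (hple hy)
      exact Ideal.mul_mem_mul hxm ((hpp.mem_or_mem hy).resolve_left hpx)
    rw [hpbot] at hpp
    exact (IsDomain.of_bot_isPrime R)

theorem isDomain_of_regular (R : Type*) [CommRing R] [IsRegularLocalRing R] : IsDomain R :=
  isDomain_of_regular_aux _ R rfl

theorem dim_eq_of_integral (R S : Type*) [CommRing R] [CommRing S] [Algebra R S]
    [Algebra.IsIntegral R S] [FaithfulSMul R S] : ringKrullDim R = ringKrullDim S := by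
  apply le_antisymm
  · refine iSup_le fun l => ?_
    obtain ⟨Q, hQ1, hQ2⟩ := (Ideal.nonempty_primesOver (S := S) l.head.asIdeal).some
    obtain ⟨L, hL, -⟩ := Ideal.exists_ltSeries_of_hasGoingUp l Q
    rw [← hL]
    exact le_iSup (fun p : LTSeries (PrimeSpectrum S) => (p.length : WithBot ℕ∞)) L
  · refine Order.krullDim_le_of_strictMono (PrimeSpectrum.comap (algebraMap R S)) ?_
    intro I J hIJ
    exact Ideal.IsIntegral.comap_lt_comap (R := R) (I := I.asIdeal) (J := J.asIdeal) hIJ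

theorem core_facts {A : Type*} [CommRing A]
    (A₀ : Subring A) (A₁ : Submodule A₀ A)
    [IsNoetherianRing A₀] [IsLocalRing A₀]
    (hgr : ∀ x ∈ A₁, ∀ y ∈ A₁, x * y ∈ A₀)
    (hdisj : A₀.toAddSubgroup ⊓ A₁.toAddSubgroup = ⊥)
    (hspan : A₀.toAddSubgroup ⊔ A₁.toAddSubgroup = ⊤)
    (hA₁ne : A₁ ≠ ⊥)
    (hm : ∀ x ∈ A₁, ∀ y ∈ A₁, ∀ h : x * y ∈ A₀, (⟨x * y, h⟩ : A₀) ∈ maximalIdeal A₀)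
    [IsNoetherianRing A] [IsLocalRing A] (e : A) (he : e ∈ A₁) (hsp : A₁ = Submodule.span A₀ {e}) :
    ringKrullDim A₀ = ringKrullDim A ∧
    (maximalIdeal A).spanFinrank ≤ (maximalIdeal A₀).spanFinrank + 1 ∧
    (maximalIdeal A₀).spanFinrank ≤ (maximalIdeal A).spanFinrank ∧
    ((⟨e * e, hgr e he e he⟩ : A₀) ∉ (maximalIdeal A₀) ^ 2 →
      (maximalIdeal A).spanFinrank ≤ (maximalIdeal A₀).spanFinrank) ∧
    ((⟨e * e, hgr e he e he⟩ : A₀) ∈ (maximalIdeal A₀) ^ 2 →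
      (maximalIdeal A₀).spanFinrank + 1 ≤ (maximalIdeal A).spanFinrank) := by
  have htm := hm e he e he (hgr e he e he)
  set t : A₀ := ⟨e * e, hgr e he e he⟩ with ht
  have hte : (t : A) = e * e := rfl
  have hdec : ∀ (a : A₀) (y : A), y ∈ A₁ → (a : A) = y → a = 0 ∧ y = 0 := by
    intro a y hy hay
    have h1 : (a : A) ∈ A₀.toAddSubgroup ⊓ A₁.toAddSubgroup := ⟨a.2, by rw [hay]; exact hy⟩
    rw [hdisj] at h1
    have h2 : (a : A) = 0 := h1
    exact ⟨Subtype.ext h2, hay ▸ h2⟩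
  have hme : ∀ b : A₀, (b : A) * e ∈ A₁ := fun b => A₁.smul_mem b he
  have hall : ∀ z : A, ∃ a b : A₀, z = a + b * e := by
    intro z
    have hz : z ∈ A₀.toAddSubgroup ⊔ A₁.toAddSubgroup := by rw [hspan]; trivial
    obtain ⟨a, ha, y, hy, rfl⟩ := AddSubgroup.mem_sup.1 hz
    have hy' : y ∈ Submodule.span A₀ {e} := by rw [← hsp]; exact hy
    obtain ⟨b, rfl⟩ := Submodule.mem_span_singleton.1 hy'
    exact ⟨⟨a, ha⟩, b, rfl⟩
  have he0 : e ≠ 0 := by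
    rintro rfl
    exact hA₁ne (by rw [hsp]; simp)
  have heM : e ∈ maximalIdeal A := by
    by_contra hcon
    have hu : IsUnit e := by simpa using hcon
    obtain ⟨u, hu⟩ := hu.exists_right_inv
    obtain ⟨a, b, rfl⟩ := hall u
    have := (hdec (1 - b * t) (a * e) (hme a) (by push_cast; rw [hte]; linear_combination -hu)).1
    have h1 : (1 : A₀) ∈ maximalIdeal A₀ := by
      rw [sub_eq_zero.1 this]; exact Ideal.mul_mem_left _ _ htm
    exact (Ideal.ne_top_iff_one _).1 (maximalIdeal.isMaximal A₀).ne_top h1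
  have hMdec : ∀ z ∈ maximalIdeal A, ∃ a b : A₀, a ∈ maximalIdeal A₀ ∧ z = a + b * e := by
    intro z hz
    obtain ⟨a, b, rfl⟩ := hall z
    refine ⟨a, b, ?_, rfl⟩
    by_contra hcon
    have hu : IsUnit a := by simpa using hcon
    have hu' : IsUnit (a : A) := hu.map A₀.subtype
    have : (a : A) ∈ maximalIdeal A := by
      have := sub_mem hz (Ideal.mul_mem_left _ (b : A) heM)
      simpa using this
    exact this hu'
  have heM2 : e ∉ maximalIdeal A ^ 2 := by
    intro hcon
    have key : ∀ z ∈ maximalIdeal A * maximalIdeal A,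
        ∃ a b : A₀, b ∈ maximalIdeal A₀ ∧ z = a + b * e := by
      intro z hz
      refine Submodule.mul_induction_on hz ?_ ?_
      · intro x hx y hy
        obtain ⟨a, b, ha, rfl⟩ := hMdec x hx
        obtain ⟨c, d, hc, rfl⟩ := hMdec y hy
        refine ⟨a * c + b * d * t, a * d + c * b,
          add_mem (Ideal.mul_mem_right _ _ ha) (Ideal.mul_mem_right _ _ hc), ?_⟩
        push_cast
        rw [hte]
        ring
      · rintro x y ⟨a, b, hb, rfl⟩ ⟨c, d, hd, rfl⟩
        refine ⟨a + c, b + d, add_mem hb hd, ?_⟩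
        push_cast
        ring
    rw [pow_two] at hcon
    obtain ⟨a, b, hb, hab⟩ := key e hcon
    have h0 := (hdec a ((1 - b : A₀) * e) (hme _) (by push_cast; linear_combination -hab)).2
    have hu : IsUnit (1 - b : A₀) := by
      by_contra hn
      have : (1 - b : A₀) ∈ maximalIdeal A₀ := hn
      have h1 := add_mem this hb
      rw [sub_add_cancel] at h1
      exact (Ideal.ne_top_iff_one _).1 (maximalIdeal.isMaximal A₀).ne_top h1
    have hu' : IsUnit ((1 - b : A₀) : A) := hu.map A₀.subtype
    exact he0 (hu'.mul_right_eq_zero.1 h0)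
  have hint : Algebra.IsIntegral A₀ A := by
    constructor
    intro z
    obtain ⟨a, b, rfl⟩ := hall z
    have hie : IsIntegral A₀ e := by
      refine IsIntegral.of_pow (n := 2) two_pos ?_
      rw [pow_two, ← hte]
      exact isIntegral_algebraMap (R := A₀) (A := A) (x := t)
    exact (isIntegral_algebraMap (R := A₀) (A := A) (x := a)).add
      ((isIntegral_algebraMap (R := A₀) (A := A) (x := b)).mul hie)
  have hdim : ringKrullDim A₀ = ringKrullDim A := dim_eq_of_integral A₀ A
  have hne : Ideal.span {e} ≠ (⊤ : Ideal A) := by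
    rw [Ne, Ideal.span_singleton_eq_top]
    exact heM
  have : Nontrivial (A ⧸ Ideal.span {e}) := Ideal.Quotient.nontrivial_iff.2 hne
  have : IsLocalRing (A ⧸ Ideal.span {e}) :=
    .of_surjective' (Ideal.Quotient.mk _) Ideal.Quotient.mk_surjective
  have hq0 : Ideal.Quotient.mk (Ideal.span {e}) e = 0 :=
    Ideal.Quotient.eq_zero_iff_mem.2 (Ideal.mem_span_singleton_self e)
  let f : A₀ →+* A ⧸ Ideal.span {e} := (Ideal.Quotient.mk _).comp A₀.subtype
  have hf : Function.Surjective f := by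
    intro q
    obtain ⟨z, rfl⟩ := Ideal.Quotient.mk_surjective q
    obtain ⟨a, b, rfl⟩ := hall z
    refine ⟨a, ?_⟩
    rw [map_add, map_mul, hq0, mul_zero, add_zero]
    rfl
  have hft : f t = 0 := by
    change Ideal.Quotient.mk _ (e * e) = 0
    rw [map_mul, hq0, mul_zero]
  have hker : RingHom.ker f = Ideal.span {t} := by
    apply le_antisymm
    · intro a ha
      have ha' : (a : A) ∈ Ideal.span {e} := Ideal.Quotient.eq_zero_iff_mem.1 ha
      obtain ⟨z, hz⟩ := Ideal.mem_span_singleton.1 ha'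
      obtain ⟨c, d, rfl⟩ := hall z
      have := (hdec (a - d * t) (c * e) (hme c)
        (by push_cast; rw [hte]; linear_combination hz)).1
      rw [sub_eq_zero.1 this]
      exact Ideal.mul_mem_left _ _ (Ideal.mem_span_singleton_self t)
    · rw [Ideal.span_singleton_le_iff_mem]
      exact hft
  have a1 := v_le_add_one (Ideal.Quotient.mk (Ideal.span {e})) Ideal.Quotient.mk_surjective
    Ideal.mk_ker
  have a2 := v_add_one_le (Ideal.Quotient.mk (Ideal.span {e})) Ideal.Quotient.mk_surjective
    hq0 heM heM2
  have a3 := v_le_add_one f hf hker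
  have a4 := v_le_of_mem_sq f hf hker
  have a5 := v_add_one_le f hf hft htm
  have a6 : (maximalIdeal (A ⧸ Ideal.span {e})).spanFinrank ≤ (maximalIdeal A₀).spanFinrank := by
    rw [← map_max_of_surj f hf]
    exact Ideal.spanFinrank_map_le_of_fg f (IsNoetherian.noetherian _)
  refine ⟨hdim, by omega, by omega, fun h => ?_, fun h => ?_⟩
  · have := a5 h
    omega
  · have := a4 h
    omega

/-- Let `A = A₀ ⊕ A₁` be a `ℤ/2ℤ`-graded commutative ring (`A₀` a subring, `A₁` an
`A₀`-submodule, `A = A₀ ⊕ A₁` additively, `A₁·A₁ ⊆ A₀`) with `(A₀, m₀)` a Noetherian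
local ring, `A₁` a nonzero finitely generated `A₀`-module with `μ_{A₀}(A₁) = 1`, and
`x·y ∈ m₀` for all `x, y ∈ A₁`, so that `A` is a Noetherian local ring. Then `A` is a
regular local ring (i.e. `dim A = v(A)`) iff `A₀` is a regular local ring, `A₁` is a free
`A₀`-module of rank one with basis element `e`, and `e² ∉ m₀²`. -/
theorem regular_iff_of_z2graded_mu_one {A : Type*} [CommRing A]
    (A₀ : Subring A) (A₁ : Submodule A₀ A)
    [IsNoetherianRing A₀] [IsLocalRing A₀]
    (hgr : ∀ x ∈ A₁, ∀ y ∈ A₁, x * y ∈ A₀)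
    (hdisj : A₀.toAddSubgroup ⊓ A₁.toAddSubgroup = ⊥)
    (hspan : A₀.toAddSubgroup ⊔ A₁.toAddSubgroup = ⊤)
    (hA₁ne : A₁ ≠ ⊥) (hA₁fg : A₁.FG) (hA₁mu : minGen A₀ A₁ = 1)
    (hm : ∀ x ∈ A₁, ∀ y ∈ A₁, ∀ h : x * y ∈ A₀, (⟨x * y, h⟩ : A₀) ∈ maximalIdeal A₀)
    [IsNoetherianRing A] [IsLocalRing A] :
    ringKrullDim A = (minGen A (maximalIdeal A) : WithBot ℕ∞) ↔
      (ringKrullDim A₀ = (minGen A₀ (maximalIdeal A₀) : WithBot ℕ∞) ∧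
        ∃ e : A, ∃ he : e ∈ A₁, A₁ = Submodule.span A₀ {e} ∧
          (∀ a : A₀, a • e = 0 → a = 0) ∧
          (⟨e * e, hgr e he e he⟩ : A₀) ∉ (maximalIdeal A₀) ^ 2) := by
  rw [minGen_eq_spanFinrank, minGen_eq_spanFinrank]
  rw [minGen_eq_spanFinrank] at hA₁mu
  constructor
  · intro hA
    obtain ⟨e, hsp⟩ := ((Submodule.spanFinrank_eq_one_iff _).1 hA₁mu).1
    have he : e ∈ A₁ := by rw [hsp]; exact Submodule.mem_span_singleton_self e
    obtain ⟨hdim, h1, h2, h3, h4⟩ :=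
      core_facts A₀ A₁ hgr hdisj hspan hA₁ne hm e he hsp
    have hle := ringKrullDim_le_spanFinrank_maximalIdeal A₀
    have hle' : (maximalIdeal A).spanFinrank ≤ (maximalIdeal A₀).spanFinrank := by
      rw [hdim, hA] at hle
      exact_mod_cast hle
    have heq : (maximalIdeal A).spanFinrank = (maximalIdeal A₀).spanFinrank := le_antisymm hle' h2
    have hA0 : ringKrullDim A₀ = ((maximalIdeal A₀).spanFinrank : WithBot ℕ∞) := by
      rw [hdim, hA, heq]
    have ht : (⟨e * e, hgr e he e he⟩ : A₀) ∉ (maximalIdeal A₀) ^ 2 := by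
      intro h
      have := h4 h
      omega
    have hreg : IsRegularLocalRing A₀ := (isRegularLocalRing_iff _).2 hA0.symm
    have := isDomain_of_regular A₀
    refine ⟨hA0, e, he, hsp, ?_, ht⟩
    intro a ha
    have hat : a * (⟨e * e, hgr e he e he⟩ : A₀) = 0 := by
      apply Subtype.ext
      have ha' : (a : A) * e = 0 := ha
      change (a : A) * (e * e) = 0
      rw [← mul_assoc, ha', zero_mul]
    rcases mul_eq_zero.1 hat with h | h
    · exact h
    · rw [h] at ht
      exact absurd (zero_mem _) ht
  · rintro ⟨hA0, e, he, hsp, -, ht⟩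
    obtain ⟨hdim, h1, h2, h3, h4⟩ :=
      core_facts A₀ A₁ hgr hdisj hspan hA₁ne hm e he hsp
    rw [← hdim, hA0, le_antisymm h2 (h3 ht)]
end
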